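/- arXiv:1205.0772 — 4 statements merged into one kernel-verified Lean document; each statement's English description precedes it below -/
import Mathlib

section
/- Let K be a field of characteristic zero and P ⊂ S a toric ideal of height r. If P = rad((g_1,...,g_r)) for some binomials g_1,...,g_r, then P = (g_1,...,g_r). -/
open MvPolynomial

noncomputable section

/-- View a function `Fin s → ℕ` as a finitely supported function (an exponent vector). -/
abbrev toFs {s : ℕ} (a : Fin s → ℕ) : Fin s →₀ ℕ := Finsupp.equivFunOnFinite.symm a

/-- The coercion of an exponent vector to `ℤ`. -/
abbrev intVec {s : ℕ} (a : Fin s → ℕ) : Fin s → ℤ := fun i => (a i : ℤ)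

/-- The lattice ideal `I(𝓛)` of a lattice `𝓛 ⊆ ℤ^s`, generated by the binomials
`t^{a⁺} - t^{a⁻}` for `a ∈ 𝓛`. -/
def latticeIdeal {s : ℕ} (K : Type*) [Field K] (𝓛 : AddSubgroup (Fin s → ℤ)) :
    Ideal (MvPolynomial (Fin s) K) :=
  Ideal.span {f | ∃ a ∈ 𝓛,
    f = monomial (toFs fun i => (a i).toNat) (1 : K) - monomial (toFs fun i => (-a i).toNat) 1}

/-- A binomial `t^a - t^b`. -/
def IsBinomial {s : ℕ} {K : Type*} [Field K] (f : MvPolynomial (Fin s) K) : Prop :=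
  ∃ a b : Fin s → ℕ, f = monomial (toFs a) (1 : K) - monomial (toFs b) 1

/-- The affine zero set `V(I) ⊆ 𝔸_K^s` of an ideal of `K[t_1, …, t_s]`. -/
def zeroSet {s : ℕ} {K : Type*} [Field K] (I : Ideal (MvPolynomial (Fin s) K)) :
    Set (Fin s → K) := {x | ∀ f ∈ I, eval x f = 0}

/-- The height of an ideal: the infimum of the heights of the primes containing it. -/
def idealHeight {R : Type*} [CommRing R] (I : Ideal R) : ℕ∞ :=
  ⨅ p ∈ {p : PrimeSpectrum R | I ≤ p.asIdeal}, Order.height p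


/-- `x` is a nonzerodivisor modulo `J`. -/
def RegMod {R : Type*} [CommRing R] (J : Ideal R) (x : R) : Prop := ∀ u, x * u ∈ J → u ∈ J

/-- The depth of `R ⧸ J` with respect to `m` is at least `n`. -/
def DepthGE {R : Type*} [CommRing R] (m : Ideal R) : ℕ → Ideal R → Prop
  | 0, _ => True
  | n + 1, J => ∃ x ∈ m, RegMod J x ∧ DepthGE m n (J ⊔ Ideal.span {x})

theorem mem_sup_span {R : Type*} [CommRing R] {J : Ideal R} {x u : R} :
    u ∈ J ⊔ Ideal.span {x} ↔ ∃ w, u - x * w ∈ J := by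
  rw [Submodule.mem_sup]
  constructor
  · rintro ⟨j, hj, z, hz, rfl⟩
    obtain ⟨w, rfl⟩ := Ideal.mem_span_singleton.1 hz
    exact ⟨w, by simpa using hj⟩
  · rintro ⟨w, hw⟩
    exact ⟨_, hw, x * w, Ideal.mem_span_singleton.2 ⟨w, rfl⟩, by ring⟩

theorem ass_exists {R : Type*} [CommRing R] [IsNoetherianRing R] {J A : Ideal R} {u : R}
    (hu : u ∉ J) (hA : ∀ a ∈ A, a * u ∈ J) : ∃ Q ∈ associatedPrimes R (R ⧸ J), A ≤ Q := by
  obtain ⟨Q, hQ, hle⟩ := exists_le_isAssociatedPrime_of_isNoetherianRing R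
    (Ideal.Quotient.mk J u) (by rwa [Ne, Ideal.Quotient.eq_zero_iff_mem])
  refine ⟨Q, hQ, fun a ha => hle ?_⟩
  rw [Submodule.mem_colon_singleton, Submodule.mem_bot]
  have := hA a ha
  rw [← Ideal.Quotient.eq_zero_iff_mem] at this
  rw [← this, Algebra.smul_def, map_mul]; rfl

theorem ass_wit {R : Type*} [CommRing R] [IsNoetherianRing R] {J Q : Ideal R}
    (hQ : Q ∈ associatedPrimes R (R ⧸ J)) : Q.IsPrime ∧ ∃ u, u ∉ J ∧ ∀ q ∈ Q, q * u ∈ J := by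
  rw [AssociatedPrimes.mem_iff, isAssociatedPrime_iff] at hQ
  obtain ⟨hp, x, hx⟩ := hQ
  obtain ⟨u, rfl⟩ := Ideal.Quotient.mk_surjective x
  refine ⟨hp, u, ?_, ?_⟩
  · intro h
    rw [← Ideal.Quotient.eq_zero_iff_mem] at h
    apply hp.ne_top
    rw [hx, h]; ext; simp
  · intro q hq
    rw [hx, Submodule.mem_colon_singleton, Submodule.mem_bot] at hq
    rw [← Ideal.Quotient.eq_zero_iff_mem, ← hq, Algebra.smul_def, map_mul]; rfl

theorem exists_ass_of_no_reg {R : Type*} [CommRing R] [IsNoetherianRing R] (m : Ideal R)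
    (S : Set (Ideal R)) (hS : S.Finite) (h : ∀ z ∈ m, ∃ J ∈ S, ¬ RegMod J z) :
    ∃ J ∈ S, ∃ u, u ∉ J ∧ ∀ a ∈ m, a * u ∈ J := by
  have hfin : (⋃ J ∈ S, associatedPrimes R (R ⧸ J)).Finite :=
    hS.biUnion fun J _ => associatedPrimes.finite R (R ⧸ J)
  have := (m.subset_union_prime_finite hfin (f := id) 0 0 (by
    intro i hi _ _
    simp only [Set.mem_iUnion] at hi
    obtain ⟨J, _, hi⟩ := hi
    exact (ass_wit hi).1)).1 (by
    intro z hz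
    obtain ⟨J, hJ, hn⟩ := h z hz
    simp only [RegMod, not_forall] at hn
    obtain ⟨u, hu, hu'⟩ := hn
    obtain ⟨Q, hQ, hle⟩ := ass_exists (A := Ideal.span {z}) hu' (by
      intro a ha
      obtain ⟨c, rfl⟩ := Ideal.mem_span_singleton.1 ha
      rw [show z * c * u = c * (z * u) by ring]
      exact J.mul_mem_left _ hu)
    simp only [Set.mem_iUnion, id]
    exact ⟨Q, ⟨J, hJ, hQ⟩, hle (Ideal.mem_span_singleton_self z)⟩)
  obtain ⟨Q, hQ, hle⟩ := this
  simp only [Set.mem_iUnion] at hQ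
  obtain ⟨J, hJ, hQ⟩ := hQ
  obtain ⟨_, u, hu, hu'⟩ := ass_wit hQ
  exact ⟨J, hJ, u, hu, fun a ha => hu' a (hle ha)⟩

theorem exch {R : Type*} [CommRing R] [IsNoetherianRing R] {m J : Ideal R} {x y : R}
    (hx : x ∈ m) (hy : y ∈ m) (hxr : RegMod J x) (hyr : RegMod J y)
    (h : ∃ z ∈ m, RegMod (J ⊔ Ideal.span {x}) z) : ∃ z ∈ m, RegMod (J ⊔ Ideal.span {y}) z := by
  by_contra hcon
  push Not at hcon
  obtain ⟨J', hJ', u, hu, hmu⟩ := exists_ass_of_no_reg m {J ⊔ Ideal.span {y}} (Set.finite_singleton _)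
    (fun z hz => ⟨_, rfl, hcon z hz⟩)
  obtain rfl : J' = _ := hJ'
  obtain ⟨w, hw⟩ := mem_sup_span.1 (hmu x hx)
  obtain ⟨z, hz, hzr⟩ := h
  have hwn : w ∉ J ⊔ Ideal.span {x} := by
    intro hmem
    obtain ⟨w', hw'⟩ := mem_sup_span.1 hmem
    apply hu
    refine mem_sup_span.2 ⟨w', hxr _ ?_⟩
    have : x * (u - y * w') = (x * u - y * w) + y * (w - x * w') := by ring
    rw [this]
    exact J.add_mem hw (J.mul_mem_left _ hw')
  apply hwn
  apply hzr
  obtain ⟨c, hc⟩ := mem_sup_span.1 (hmu z hz)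
  refine mem_sup_span.2 ⟨c, hyr _ ?_⟩
  have : y * (z * w - x * c) = x * (z * u - y * c) - z * (x * u - y * w) := by ring
  rw [this]
  exact J.sub_mem (J.mul_mem_left _ hc) (J.mul_mem_left _ hw)

theorem reg_swap {R : Type*} [CommRing R] {J : Ideal R} {y z : R} (hy : RegMod J y)
    (hz : RegMod (J ⊔ Ideal.span {y}) z) : RegMod (J ⊔ Ideal.span {z}) y := by
  intro u hu
  obtain ⟨w, hw⟩ := mem_sup_span.1 hu
  have : w ∈ J ⊔ Ideal.span {y} := by
    apply hz
    refine mem_sup_span.2 ⟨u, ?_⟩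
    rw [← neg_sub]; exact J.neg_mem hw
  obtain ⟨w', hw'⟩ := mem_sup_span.1 this
  refine mem_sup_span.2 ⟨w', hy _ ?_⟩
  have : y * (u - z * w') = (y * u - z * w) + z * (w - y * w') := by ring
  rw [this]
  exact J.add_mem hw (J.mul_mem_left _ hw')

theorem depth_quot {R : Type*} [CommRing R] [IsNoetherianRing R] {m : Ideal R} (n : ℕ) :
    ∀ (J : Ideal R) (x : R), x ∈ m → RegMod J x → DepthGE m (n + 1) J →
      DepthGE m n (J ⊔ Ideal.span {x}) := by
  induction n with
  | zero => intros; trivial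
  | succ n ih =>
    rintro J x hx hxr ⟨y, hy, hyr, hd⟩
    have hyz : ∃ z ∈ m, RegMod (J ⊔ Ideal.span {y}) z := by
      obtain ⟨z, hz, hzr, _⟩ := hd
      exact ⟨z, hz, hzr⟩
    have hxz := exch hy hx hyr hxr hyz
    obtain ⟨z, hz, h1, h2, h3⟩ : ∃ z ∈ m, RegMod J z ∧ RegMod (J ⊔ Ideal.span {x}) z ∧
        RegMod (J ⊔ Ideal.span {y}) z := by
      by_contra hcon
      push Not at hcon
      obtain ⟨J', hJ', u, hu, hmu⟩ := exists_ass_of_no_reg m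
        {J, J ⊔ Ideal.span {x}, J ⊔ Ideal.span {y}} (Set.toFinite _) (by
          intro z hz
          by_contra hc
          push Not at hc
          exact hcon z hz (hc _ (by simp)) (hc _ (by simp)) (hc _ (by simp)))
      rcases hJ' with rfl | rfl | rfl
      · exact hu (hxr _ (hmu x hx))
      · obtain ⟨z, hz, hr⟩ := hxz
        exact hu (hr _ (hmu z hz))
      · obtain ⟨z, hz, hr⟩ := hyz
        exact hu (hr _ (hmu z hz))
    have e1 := ih _ z hz h3 hd
    have e2 : DepthGE m (n + 1) (J ⊔ Ideal.span {z}) :=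
      ⟨y, hy, reg_swap hyr h3, by rwa [sup_right_comm]⟩
    have e3 := ih _ x hx (reg_swap hxr h2) e2
    exact ⟨z, hz, h2, by rwa [sup_right_comm]⟩

theorem dim_anti {R : Type*} [CommRing R] {A B : Ideal R} (h : A ≤ B) :
    ringKrullDim (R ⧸ B) ≤ ringKrullDim (R ⧸ A) :=
  ringKrullDim_le_of_surjective (Ideal.Quotient.factor h) (Ideal.Quotient.factor_surjective h)

theorem dim_prime_succ {R : Type*} [CommRing R] {Q A : Ideal R} [Q.IsPrime] {x : R}
    (hx : x ∉ Q) (hQA : Q ⊔ Ideal.span {x} ≤ A) :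
    ringKrullDim (R ⧸ A) + 1 ≤ ringKrullDim (R ⧸ Q) := by
  refine ringKrullDim_succ_le_of_surjective (Ideal.Quotient.factor (le_sup_left.trans hQA))
    (Ideal.Quotient.factor_surjective _) (r := Ideal.Quotient.mk Q x) ?_ ?_
  · rw [mem_nonZeroDivisors_iff_ne_zero, Ne, Ideal.Quotient.eq_zero_iff_mem]
    exact hx
  · rw [Ideal.Quotient.factor_mk, Ideal.Quotient.eq_zero_iff_mem]
    exact hQA (Ideal.mem_sup_right (Ideal.mem_span_singleton_self x))

theorem ischebeck {R : Type*} [CommRing R] [IsNoetherianRing R] [IsLocalRing R] (n : ℕ) :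
    ∀ (J A : Ideal R) (u : R), u ∉ J → (∀ a ∈ A, a * u ∈ J) →
      DepthGE (IsLocalRing.maximalIdeal R) n J →
      (n : WithBot ℕ∞) ≤ ringKrullDim (R ⧸ A) := by
  induction n with
  | zero =>
    intro J A u hu hA _
    have : Nontrivial (R ⧸ A) := Ideal.Quotient.nontrivial_iff.2 (by
      rintro rfl
      exact hu (by simpa using hA 1 trivial))
    exact_mod_cast ringKrullDim_nonneg_of_nontrivial
  | succ n ih =>
    rintro J A u hu hA ⟨x, hx, hxr, hd⟩
    obtain ⟨Q, hQ, hAQ⟩ := ass_exists hu hA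
    obtain ⟨hQp, v, hv, hQv⟩ := ass_wit hQ
    have hxQ : x ∉ Q := fun h => hv (hxr _ (hQv x h))
    obtain ⟨w, hw, hwx⟩ : ∃ w, (∀ q ∈ Q, q * w ∈ J) ∧ w ∉ J ⊔ Ideal.span {x} := by
      by_contra hcon
      push Not at hcon
      let N : Ideal R :=
        { carrier := {w | ∀ q ∈ Q, q * w ∈ J}
          add_mem' := fun {a b} ha hb q hq => by
            rw [mul_add]; exact J.add_mem (ha q hq) (hb q hq)
          zero_mem' := fun q _ => by simp
          smul_mem' := fun c a ha q hq => by
            rw [smul_eq_mul, mul_left_comm]; exact J.mul_mem_left _ (ha q hq) }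
      have hN : N ≤ J := by
        apply Submodule.le_of_le_smul_of_le_jacobson_bot (I := IsLocalRing.maximalIdeal R)
          (IsNoetherian.noetherian N) (IsLocalRing.maximalIdeal_le_jacobson _)
        intro a ha
        obtain ⟨b, hb⟩ := mem_sup_span.1 (hcon a ha)
        have hbN : b ∈ N := by
          intro q hq
          apply hxr
          have : x * (q * b) = q * a - q * (a - x * b) := by ring
          rw [this]
          exact J.sub_mem (ha q hq) (J.mul_mem_left _ hb)
        rw [Submodule.mem_sup]
        exact ⟨_, hb, x * b, Ideal.mul_mem_mul hx hbN, by ring⟩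
      exact hv (hN hQv)
    have key := ih (J ⊔ Ideal.span {x}) (Q ⊔ Ideal.span {x}) w hwx (by
      intro a ha
      obtain ⟨c, hc⟩ := mem_sup_span.1 ha
      refine mem_sup_span.2 ⟨c * w, ?_⟩
      have : a * w - x * (c * w) = (a - x * c) * w := by ring
      rw [this]
      exact hw _ hc) hd
    calc ((n + 1 : ℕ) : WithBot ℕ∞) = n + 1 := by push_cast; rfl
      _ ≤ ringKrullDim (R ⧸ (Q ⊔ Ideal.span {x})) + 1 := by gcongr
      _ ≤ ringKrullDim (R ⧸ Q) := dim_prime_succ hxQ le_rfl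
      _ ≤ ringKrullDim (R ⧸ A) := dim_anti hAQ

theorem dim_quot_succ {R : Type*} [CommRing R] [IsNoetherianRing R] [IsLocalRing R] (J : Ideal R)
    {x : R} (hx : x ∈ IsLocalRing.maximalIdeal R) :
    ringKrullDim (R ⧸ J) ≤ ringKrullDim (R ⧸ (J ⊔ Ideal.span {x})) + 1 := by
  have h := ringKrullDim_le_ringKrullDim_quotient_add_encard ({Ideal.Quotient.mk J x} : Set (R ⧸ J)) (by
    rw [Set.singleton_subset_iff, SetLike.mem_coe, ← Ideal.jacobson_bot, Ideal.mem_jacobson_bot]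
    intro y
    obtain ⟨y, rfl⟩ := Ideal.Quotient.mk_surjective y
    rw [← map_mul, ← map_one (Ideal.Quotient.mk J), ← map_add]
    apply IsUnit.map
    by_contra hc
    have h1 : x * y + 1 ∈ IsLocalRing.maximalIdeal R := hc
    have h2 : (1 : R) ∈ IsLocalRing.maximalIdeal R := by
      have := Ideal.sub_mem _ h1 (Ideal.mul_mem_right y _ hx)
      simpa using this
    exact h2 isUnit_one)
  rw [Set.encard_singleton] at h
  refine h.trans ?_
  have e : ringKrullDim ((R ⧸ J) ⧸ Ideal.span {Ideal.Quotient.mk J x})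
      = ringKrullDim (R ⧸ (J ⊔ Ideal.span {x})) := by
    rw [← ringKrullDim_eq_of_ringEquiv (DoubleQuot.quotQuotEquivQuotSup J (Ideal.span {x})),
      Ideal.map_span, Set.image_singleton]
  rw [e]
  rfl

theorem dim_radical {R : Type*} [CommRing R] (I : Ideal R) :
    ringKrullDim (R ⧸ I) = ringKrullDim (R ⧸ I.radical) := by
  rw [ringKrullDim_quotient, ringKrullDim_quotient, PrimeSpectrum.zeroLocus_radical]

/-- ideal generated by the first `i` elements -/
def firstIdeal {R : Type*} [CommRing R] {r : ℕ} (g : Fin r → R) (i : ℕ) : Ideal R :=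
  Ideal.span (g '' {j | j.val < i})

theorem firstIdeal_succ {R : Type*} [CommRing R] {r : ℕ} (g : Fin r → R) (i : Fin r) :
    firstIdeal g (i.val + 1) = firstIdeal g i.val ⊔ Ideal.span {g i} := by
  rw [firstIdeal, firstIdeal, ← Ideal.span_union, ← Set.image_singleton, ← Set.image_union]
  congr 2
  ext j
  simp only [Set.mem_ofPred_eq, Set.mem_union, Set.mem_singleton_iff, Fin.ext_iff]
  omega

theorem firstIdeal_zero {R : Type*} [CommRing R] {r : ℕ} (g : Fin r → R) :
    firstIdeal g 0 = ⊥ := by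
  simp [firstIdeal]

theorem firstIdeal_last {R : Type*} [CommRing R] {r : ℕ} (g : Fin r → R) :
    firstIdeal g r = Ideal.span (Set.range g) := by
  rw [firstIdeal, ← Set.image_univ]
  congr 2
  ext j
  simp

theorem local_unmixed {R : Type*} [CommRing R] [IsNoetherianRing R] [IsLocalRing R] {r s : ℕ}
    (g : Fin r → R) (hs : DepthGE (IsLocalRing.maximalIdeal R) s (⊥ : Ideal R))
    (P : Ideal R) [P.IsPrime] (hrad : (Ideal.span (Set.range g)).radical = P)
    (hdim : ringKrullDim (R ⧸ P) + r ≤ s) (t : R) (ht : t ∉ P) :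
    RegMod (Ideal.span (Set.range g)) t := by
  have hgm : ∀ j, g j ∈ IsLocalRing.maximalIdeal R := fun j =>
    IsLocalRing.le_maximalIdeal (Ideal.IsPrime.ne_top ‹P.IsPrime›)
      (hrad ▸ Ideal.le_radical (Ideal.subset_span ⟨j, rfl⟩))
  obtain ⟨d, hd⟩ : ∃ d : ℕ, ringKrullDim (R ⧸ P) = d := by
    have h0 : 0 ≤ ringKrullDim (R ⧸ P) := ringKrullDim_nonneg_of_nontrivial
    generalize ringKrullDim (R ⧸ P) = a at *
    induction a with
    | bot => simp at h0
    | coe a =>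
      induction a with
      | top => exact absurd hdim (by
          rw [show ((⊤ : ℕ∞) : WithBot ℕ∞) + (r : WithBot ℕ∞) = ((⊤ + r : ℕ∞) : WithBot ℕ∞) from rfl,
            show (s : WithBot ℕ∞) = ((s : ℕ∞) : WithBot ℕ∞) from rfl, WithBot.coe_le_coe]
          simp)
      | coe d => exact ⟨d, rfl⟩
  have hdr : d + r ≤ s := by
    rw [hd] at hdim
    exact_mod_cast hdim
  have hdims : ∀ k, k ≤ r → ringKrullDim (R ⧸ firstIdeal g (r - k)) ≤ ((d + k : ℕ) : WithBot ℕ∞) := by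
    intro k
    induction k with
    | zero =>
      intro _
      rw [Nat.sub_zero, firstIdeal_last, dim_radical, hrad, hd]; simp
    | succ k ih =>
      intro hk
      have h1 := ih (by omega)
      have h2 := dim_quot_succ (firstIdeal g (r - (k + 1))) (hgm ⟨r - (k + 1), by omega⟩)
      have h3 := firstIdeal_succ g ⟨r - (k + 1), by omega⟩
      simp only at h3
      rw [← h3, show r - (k + 1) + 1 = r - k by omega] at h2
      calc _ ≤ _ := h2
        _ ≤ ((d + k : ℕ) : WithBot ℕ∞) + 1 := by gcongr
        _ = _ := by push_cast; rw [add_assoc]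
  have hdepth : ∀ i, i ≤ r → DepthGE (IsLocalRing.maximalIdeal R) (s - i) (firstIdeal g i) := by
    intro i
    induction i with
    | zero => intro _; rw [firstIdeal_zero]; exact hs
    | succ i ih =>
      intro hi
      have h1 := ih (by omega)
      have h3 := firstIdeal_succ g ⟨i, by omega⟩
      simp only at h3
      rw [h3]
      apply depth_quot _ _ _ (hgm _)
      · by_contra hn
        simp only [RegMod, not_forall] at hn
        obtain ⟨u, hu, hu'⟩ := hn
        have h4 := ischebeck (s - i) _ (firstIdeal g (i + 1)) u hu' (by
          intro a ha
          rw [h3] at ha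
          obtain ⟨w, hw⟩ := mem_sup_span.1 ha
          have : a * u = (a - g ⟨i, by omega⟩ * w) * u + w * (g ⟨i, by omega⟩ * u) := by ring
          rw [this]
          exact Ideal.add_mem _ (Ideal.mul_mem_right _ _ hw) (Ideal.mul_mem_left _ _ hu)) h1
        have h5 := hdims (r - (i + 1)) (by omega)
        rw [show r - (r - (i + 1)) = i + 1 by omega] at h5
        have h6 := h4.trans h5
        have : s - i ≤ d + (r - (i + 1)) := by exact_mod_cast h6
        omega
      · rwa [show s - (i + 1) + 1 = s - i by omega]
  have hfin := hdepth r le_rfl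
  rw [firstIdeal_last] at hfin
  by_contra hn
  simp only [RegMod, not_forall] at hn
  obtain ⟨u, hu, hu'⟩ := hn
  obtain ⟨Q, hQ, hle⟩ := ass_exists (A := Ideal.span (Set.range g) ⊔ Ideal.span {t}) hu' (by
    intro a ha
    obtain ⟨w, hw⟩ := mem_sup_span.1 ha
    have : a * u = (a - t * w) * u + w * (t * u) := by ring
    rw [this]
    exact Ideal.add_mem _ (Ideal.mul_mem_right _ _ hw) (Ideal.mul_mem_left _ _ hu))
  obtain ⟨hQp, v, hv, hQv⟩ := ass_wit hQ
  have h4 := ischebeck (s - r) _ Q v hv hQv hfin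
  have hPQ : P ≤ Q := by
    rw [← hrad]
    exact hQp.radical_le_iff.2 (le_sup_left.trans hle)
  have h5 := dim_prime_succ ht (sup_le hPQ (le_sup_right.trans hle))
  rw [hd] at h5
  have h6 : ((s - r + 1 : ℕ) : WithBot ℕ∞) ≤ d := by
    refine le_trans ?_ h5
    push_cast
    gcongr
  have : s - r + 1 ≤ d := by exact_mod_cast h6
  omega

theorem reg_loc {R A : Type*} [CommRing R] [CommRing A] [Algebra R A] (M : Ideal R) [M.IsPrime]
    [IsLocalization.AtPrime A M] {J : Ideal R} {x : R} (h : RegMod J x) :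
    RegMod (J.map (algebraMap R A)) (algebraMap R A x) := by
  intro u hu
  obtain ⟨a, c, rfl⟩ := IsLocalization.exists_mk'_eq M.primeCompl u
  rw [← IsLocalization.mk'_one (M := M.primeCompl) A x, ← IsLocalization.mk'_mul,
    IsLocalization.mk'_mem_map_algebraMap_iff] at hu
  obtain ⟨d, hd, hd'⟩ := hu
  rw [IsLocalization.mk'_mem_map_algebraMap_iff]
  refine ⟨d, hd, h _ ?_⟩
  rwa [mul_left_comm]

theorem depth_loc {R A : Type*} [CommRing R] [CommRing A] [Algebra R A] (M : Ideal R) [M.IsPrime]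
    [IsLocalization.AtPrime A M] [IsLocalRing A] (n : ℕ) : ∀ {J : Ideal R}, DepthGE M n J →
    DepthGE (IsLocalRing.maximalIdeal A) n (J.map (algebraMap R A)) := by
  induction n with
  | zero => intros; trivial
  | succ n ih =>
    rintro J ⟨x, hx, hxr, hd⟩
    refine ⟨algebraMap R A x, ?_, reg_loc M hxr, ?_⟩
    · exact (IsLocalization.AtPrime.to_map_mem_maximal_iff A M x).2 hx
    · have := ih hd
      rwa [Ideal.map_sup, Ideal.map_span, Set.image_singleton] at this

theorem poly_reg {s : ℕ} {K : Type*} [Field K] (f : Fin s → Polynomial K) (hf : ∀ i, (f i).Monic)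
    (i : Fin s) :
    RegMod (firstIdeal (fun j => Polynomial.aeval (X j : MvPolynomial (Fin s) K) (f j)) i.val)
      (Polynomial.aeval (X i : MvPolynomial (Fin s) K) (f i)) := by
  set x := fun j => Polynomial.aeval (X j : MvPolynomial (Fin s) K) (f j) with hx
  set J := firstIdeal x i.val with hJ
  let A := MvPolynomial (Fin s) K ⧸ J
  let φ : MvPolynomial (Fin s) K →ₐ[K] Polynomial A := aeval fun j =>
    if j = i then Polynomial.X else Polynomial.C (Ideal.Quotient.mk J (X j))
  let ε : Polynomial A →+* A := Polynomial.evalRingHom (Ideal.Quotient.mk J (X i))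
  have hεφ : ∀ u, ε (φ u) = Ideal.Quotient.mk J u := by
    intro u
    have : ε.comp φ.toRingHom = Ideal.Quotient.mk J := by
      apply MvPolynomial.ringHom_ext
      · intro r
        simp only [ε, φ, RingHom.comp_apply, AlgHom.toRingHom_eq_coe, RingHom.coe_coe]
        rw [← MvPolynomial.algebraMap_eq, AlgHom.commutes, IsScalarTower.algebraMap_apply K A]
        rw [Polynomial.algebraMap_eq, Polynomial.coe_evalRingHom, Polynomial.eval_C]
        rfl
      · intro j
        simp only [ε, φ, RingHom.comp_apply, AlgHom.toRingHom_eq_coe, RingHom.coe_coe, aeval_X]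
        split_ifs with h
        · subst h; simp
        · simp
    exact congrArg (fun F => F u) this
  have hφJ : ∀ u ∈ J, φ u = 0 := by
    intro u hu
    have : J ≤ RingHom.ker φ := by
      refine Ideal.span_le.2 ?_
      rintro _ ⟨j, hj, rfl⟩
      have hji : j ≠ i := by
        rintro rfl
        simp at hj
      rw [SetLike.mem_coe, RingHom.mem_ker]
      show φ (Polynomial.aeval (X j) (f j)) = 0
      rw [← Polynomial.aeval_algHom_apply]
      simp only [φ, aeval_X, if_neg hji]
      have h1 : (Polynomial.C (Ideal.Quotient.mk J (X j)) : Polynomial A) =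
          ((Algebra.ofId A (Polynomial A)).restrictScalars K)
            ((Ideal.Quotient.mkₐ K J) (X j)) := rfl
      rw [h1, Polynomial.aeval_algHom_apply, Polynomial.aeval_algHom_apply]
      have h2 : (Ideal.Quotient.mkₐ K J) (x j) = 0 := by
        rw [Ideal.Quotient.mkₐ_eq_mk, Ideal.Quotient.eq_zero_iff_mem]
        exact Ideal.subset_span ⟨j, hj, rfl⟩
      rw [show Polynomial.aeval (X j) (f j) = x j from rfl, h2, map_zero]
    exact this hu
  intro u hu
  have h1 := hφJ _ hu
  rw [map_mul] at h1
  have h2 : φ (Polynomial.aeval (X i) (f i)) = (f i).map (algebraMap K A) := by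
    rw [← Polynomial.aeval_algHom_apply]
    simp only [φ, aeval_X, if_true]
    rw [Polynomial.aeval_def, Polynomial.eval₂_eq_eval_map]
    rw [IsScalarTower.algebraMap_eq K A (Polynomial A), ← Polynomial.map_map]
    rw [← Polynomial.eval₂_eq_eval_map, Polynomial.algebraMap_eq, Polynomial.eval₂_C_X]
  rw [h2] at h1
  have h3 := ((hf i).map (algebraMap K A)).mul_right_eq_zero_iff.1 h1
  rw [← Ideal.Quotient.eq_zero_iff_mem, ← hεφ, h3, map_zero]

theorem poly_depth {s : ℕ} {K : Type*} [Field K] (M : Ideal (MvPolynomial (Fin s) K))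
    [M.IsMaximal] : DepthGE M s ⊥ := by
  letI := Ideal.Quotient.field M
  have hfin : Module.Finite K (MvPolynomial (Fin s) K ⧸ M) :=
    finite_of_finite_type_of_isJacobsonRing _ _
  have hintegral : ∀ i : Fin s, IsIntegral K (Ideal.Quotient.mkₐ K M (X i)) := fun i =>
    Algebra.IsIntegral.isIntegral _
  let f : Fin s → Polynomial K := fun i => minpoly K (Ideal.Quotient.mkₐ K M (X i))
  have hf : ∀ i, (f i).Monic := fun i => minpoly.monic (hintegral i)
  let x := fun j => Polynomial.aeval (X j : MvPolynomial (Fin s) K) (f j)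
  have hxM : ∀ j, x j ∈ M := by
    intro j
    rw [← Ideal.Quotient.eq_zero_iff_mem, ← Ideal.Quotient.mkₐ_eq_mk K,
      ← Polynomial.aeval_algHom_apply]
    exact minpoly.aeval _ _
  have : ∀ k, k ≤ s → DepthGE M k (firstIdeal x (s - k)) := by
    intro k
    induction k with
    | zero => intros; trivial
    | succ k ih =>
      intro hk
      refine ⟨x ⟨s - (k + 1), by omega⟩, hxM _, poly_reg f hf ⟨s - (k + 1), by omega⟩, ?_⟩
      have h3 := firstIdeal_succ x ⟨s - (k + 1), by omega⟩
      simp only at h3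
      rw [← h3, show s - (k + 1) + 1 = s - k by omega]
      exact ih (by omega)
  have h := this s le_rfl
  rwa [Nat.sub_self, firstIdeal_zero] at h

theorem dim_add_height {R : Type*} [CommRing R] (P : Ideal R) [hP : P.IsPrime] :
    ringKrullDim (R ⧸ P) + Order.height (⟨P, hP⟩ : PrimeSpectrum R) ≤ ringKrullDim R := by
  have h1 : ringKrullDim (R ⧸ P) = Order.coheight (⟨P, hP⟩ : PrimeSpectrum R) := by
    rw [ringKrullDim_quotient, Order.coheight_eq_krullDim_Ici]
    rfl
  haveI : Nonempty (PrimeSpectrum R) := ⟨⟨P, hP⟩⟩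
  rw [h1, ringKrullDim, Order.krullDim_eq_iSup_height_add_coheight_of_nonempty, ← WithBot.coe_add,
    WithBot.coe_le_coe, add_comm]
  exact le_iSup (fun a : PrimeSpectrum R => Order.height a + Order.coheight a) ⟨P, hP⟩

theorem global_unmixed {s r : ℕ} {K : Type*} [Field K] (P : Ideal (MvPolynomial (Fin s) K))
    [hPp : P.IsPrime] (hht : P.height = r) (g : Fin r → MvPolynomial (Fin s) K)
    (hrad : P = (Ideal.span (Set.range g)).radical) (t : MvPolynomial (Fin s) K) (ht : t ∉ P) :
    RegMod (Ideal.span (Set.range g)) t := by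
  intro u hu
  set I := Ideal.span (Set.range g) with hI
  apply Ideal.mem_of_localization_maximal
  intro M hM
  let A := Localization.AtPrime M
  by_cases hPM : P ≤ M
  · have hdisj : Disjoint (M.primeCompl : Set (MvPolynomial (Fin s) K)) (P : Set _) := by
      rw [Set.disjoint_left]
      intro a ha hb
      exact ha (hPM hb)
    haveI hpr : (P.map (algebraMap _ A)).IsPrime :=
      IsLocalization.isPrime_of_isPrime_disjoint M.primeCompl A P hPp hdisj
    have hIm : I.map (algebraMap _ A) = Ideal.span (Set.range fun j => algebraMap _ A (g j)) := by
      rw [hI, Ideal.map_span, ← Set.range_comp]; rfl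
    rw [hIm]
    have hut : algebraMap _ A t * algebraMap _ A u ∈
        Ideal.span (Set.range fun j => algebraMap _ A (g j)) := by
      rw [← hIm, ← map_mul]; exact Ideal.mem_map_of_mem _ hu
    refine local_unmixed (s := s) (fun j => algebraMap _ A (g j)) ?_ (P.map (algebraMap _ A)) ?_ ?_ (algebraMap _ A t)
      ?_ _ hut
    · have := depth_loc (A := A) M s (poly_depth M)
      rwa [Ideal.map_bot] at this
    · rw [← hIm, ← IsLocalization.map_radical M.primeCompl, ← hrad]
    · have h1 := dim_add_height (P.map (algebraMap _ A))
      have h2 : Order.height (⟨P.map (algebraMap _ A), hpr⟩ : PrimeSpectrum A) = r := by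
        rw [← PrimeSpectrum.height_eq_orderHeight]
        exact (IsLocalization.height_map_of_disjoint M.primeCompl P hdisj).trans hht
      rw [h2] at h1
      refine h1.trans ?_
      rw [IsLocalization.AtPrime.ringKrullDim_eq_height M A]
      refine Ideal.height_le_ringKrullDim_of_isPrime.trans ?_
      rw [MvPolynomial.ringKrullDim_of_isNoetherianRing]
      simp
    · intro h
      have : t ∈ (P.map (algebraMap _ A)).under (MvPolynomial (Fin s) K) := h
      rw [IsLocalization.under_map_of_isPrime_disjoint M.primeCompl A hPp hdisj] at this
      exact ht this
  · have : I.map (algebraMap _ A) = ⊤ := by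
      have hIM : ¬ I ≤ M := fun h => hPM (by rw [hrad]; exact hM.isPrime.radical_le_iff.2 h)
      obtain ⟨a, ha, haM⟩ := SetLike.not_le_iff_exists.1 hIM
      exact Ideal.eq_top_of_isUnit_mem _ (Ideal.mem_map_of_mem _ ha)
        (IsLocalization.map_units A (⟨a, haM⟩ : M.primeCompl))
    rw [this]; trivial


theorem nilp_unip {K G : Type*} [Field K] [CharZero K] [AddCommGroup G] (u : G) (N : ℕ)
    (h : ((AddMonoidAlgebra.single u (1 : K) : AddMonoidAlgebra K G) - 1) ^ N = 0) : u = 0 := by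
  set x : AddMonoidAlgebra K G := AddMonoidAlgebra.single u (1 : K) with hx
  have hpow : ∀ k : ℕ, x ^ k = AddMonoidAlgebra.single (k • u) 1 := by
    intro k
    rw [hx, AddMonoidAlgebra.single_pow, one_pow]
  by_cases hfin : IsOfFinAddOrder u
  · have hk : 0 < addOrderOf u := hfin.addOrderOf_pos
    set k := addOrderOf u with hkd
    have hxk : x ^ k = 1 := by
      rw [hpow, addOrderOf_nsmul_eq_zero]; rfl
    have hgeom : (∑ i ∈ Finset.range k, x ^ i) * (x - 1) = 0 := by
      rw [geom_sum_mul, hxk, sub_self]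
    have hnil : IsNilpotent ((∑ i ∈ Finset.range k, x ^ i) - (k : AddMonoidAlgebra K G)) := by
      have h1 : (x - 1) ∣ ((∑ i ∈ Finset.range k, x ^ i) - (k : AddMonoidAlgebra K G)) := by
        have : ((∑ i ∈ Finset.range k, x ^ i) - (k : AddMonoidAlgebra K G))
            = ∑ i ∈ Finset.range k, (x ^ i - 1) := by
          rw [Finset.sum_sub_distrib]; simp
        rw [this]
        refine Finset.dvd_sum fun i _ => ?_
        simpa using sub_dvd_pow_sub_pow x 1 i
      obtain ⟨c, hc⟩ := h1
      exact ⟨N, by rw [hc, mul_pow, h, zero_mul]⟩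
    have hku : IsUnit (k : AddMonoidAlgebra K G) := by
      have : (k : AddMonoidAlgebra K G) = algebraMap K _ (k : K) := by simp
      rw [this]
      exact (IsUnit.mk0 (k : K) (by exact_mod_cast hk.ne')).map _
    have hu : IsUnit (∑ i ∈ Finset.range k, x ^ i) := by
      have := hnil.isUnit_add_right_of_commute hku (Commute.all _ _)
      simpa using this
    have h0 : x - 1 = 0 := (hu.mul_right_eq_zero).1 hgeom
    have h1 : x = 1 := sub_eq_zero.1 h0
    rw [hx, AddMonoidAlgebra.one_def] at h1
    exact (AddMonoidAlgebra.single_left_inj (one_ne_zero)).1 h1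
  · exfalso
    have hinj : Function.Injective fun k : ℕ => k • u :=
      injective_nsmul_iff_not_isOfFinAddOrder.2 hfin
    have key : (Polynomial.aeval x) ((Polynomial.X - 1 : Polynomial K) ^ N) = 0 := by
      simpa using h
    have hall : ∀ p : Polynomial K, Polynomial.aeval x p = 0 → p = 0 := by
      intro p hp
      let Ψ : Polynomial K →ₐ[K] AddMonoidAlgebra K G :=
        (AddMonoidAlgebra.mapDomainAlgHom K K (multiplesHom G u)).comp
          (Polynomial.toFinsuppIsoAlg K).toAlgHom
      have hΨ : Polynomial.aeval x = Ψ := by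
        apply Polynomial.algHom_ext
        simp [Ψ, hx]
      have hΨi : Function.Injective Ψ :=
        (AddMonoidAlgebra.mapDomain_injective (f := multiplesHom G u) hinj).comp
          (Polynomial.toFinsuppIsoAlg K).injective
      rw [hΨ] at hp
      exact hΨi (hp.trans (map_zero Ψ).symm)
    have := hall _ key
    exact pow_ne_zero N (Polynomial.X_sub_C_ne_zero (1 : K)) (by simpa using this)

theorem lattice_lift {s r : ℕ} {K : Type*} [Field K] (I : Ideal (MvPolynomial (Fin s) K))
    (a b : Fin r → Fin s → ℕ)
    (hI : ∀ j, monomial (toFs (a j)) (1 : K) - monomial (toFs (b j)) 1 ∈ I)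
    (u : Fin s → ℤ)
    (hu : u ∈ AddSubgroup.closure (Set.range fun j => intVec (a j) - intVec (b j))) :
    ∃ a' b' : Fin s →₀ ℕ, (∀ i, (a' i : ℤ) - b' i = u i) ∧
      monomial a' (1 : K) - monomial b' 1 ∈ I := by
  induction hu using AddSubgroup.closure_induction with
  | mem x hx =>
    obtain ⟨j, rfl⟩ := hx
    exact ⟨toFs (a j), toFs (b j), fun i => by simp, hI j⟩
  | zero => exact ⟨0, 0, fun i => by simp, by simp⟩
  | add x y _ _ hx hy =>
    obtain ⟨a1, b1, h1, h1'⟩ := hx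
    obtain ⟨a2, b2, h2, h2'⟩ := hy
    refine ⟨a1 + a2, b1 + b2, fun i => ?_, ?_⟩
    · rw [Pi.add_apply, ← h1, ← h2]; push_cast [Finsupp.add_apply]; ring
    · have e : monomial (a1 + a2) (1 : K) - monomial (b1 + b2) 1 =
          monomial a2 (1 : K) * (monomial a1 (1 : K) - monomial b1 1) +
          monomial b1 (1 : K) * (monomial a2 (1 : K) - monomial b2 1) := by
        have h3 : monomial (a1 + a2) (1 : K) = monomial a1 1 * monomial a2 1 := by
          rw [monomial_mul, one_mul]
        have h4 : monomial (b1 + b2) (1 : K) = monomial b1 1 * monomial b2 1 := by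
          rw [monomial_mul, one_mul]
        rw [h3, h4]; ring
      rw [e]
      exact I.add_mem (I.mul_mem_left _ h1') (I.mul_mem_left _ h2')
  | neg x _ hx =>
    obtain ⟨a1, b1, h1, h1'⟩ := hx
    refine ⟨b1, a1, fun i => ?_, ?_⟩
    · rw [Pi.neg_apply, ← h1]; ring
    · rw [← neg_sub]; exact I.neg_mem h1'

theorem aeval_single_monomial {s : ℕ} {K G : Type*} [Field K] [AddCommGroup G] (v : Fin s → G)
    (a : Fin s →₀ ℕ) (c : K) :
    MvPolynomial.aeval
      (fun i => (AddMonoidAlgebra.single (v i) (1 : K) : AddMonoidAlgebra K G)) (monomial a c) =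
      AddMonoidAlgebra.single (∑ i, a i • v i) c := by
  rw [aeval_monomial, Finsupp.prod_fintype _ _ (fun i => pow_zero _)]
  have : ∀ t : Finset (Fin s), ∏ i ∈ t,
      (AddMonoidAlgebra.single (v i) (1 : K) : AddMonoidAlgebra K G) ^ a i =
      AddMonoidAlgebra.single (∑ i ∈ t, a i • v i) 1 := by
    intro t
    induction t using Finset.induction_on with
    | empty => simp [AddMonoidAlgebra.one_def]
    | insert i t hi ih =>
      rw [Finset.prod_insert hi, ih, Finset.sum_insert hi, AddMonoidAlgebra.single_pow,
        AddMonoidAlgebra.single_mul_single, one_pow, one_mul]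
  rw [this, AddMonoidAlgebra.coe_algebraMap]
  simp [AddMonoidAlgebra.single_mul_single]

theorem toric_spanned {s : ℕ} {K G : Type*} [Field K] [AddCommGroup G] (v : Fin s → G)
    (J : Ideal (MvPolynomial (Fin s) K))
    (hJ : ∀ a b : Fin s →₀ ℕ, ∑ i, a i • v i = ∑ i, b i • v i →
      monomial a (1 : K) - monomial b 1 ∈ J)
    (f : MvPolynomial (Fin s) K)
    (hf : MvPolynomial.aeval
      (fun i => (AddMonoidAlgebra.single (v i) (1 : K) : AddMonoidAlgebra K G)) f = 0) :
    f ∈ J := by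
  classical
  set φ := MvPolynomial.aeval (R := K)
      (fun i => (AddMonoidAlgebra.single (v i) (1 : K) : AddMonoidAlgebra K G)) with hφ
  let deg : (Fin s →₀ ℕ) → G := fun a => ∑ i, a i • v i
  let rep : G → (Fin s →₀ ℕ) := Function.invFun deg
  have hrep : ∀ a, deg (rep (deg a)) = deg a := fun a => Function.invFun_eq ⟨a, rfl⟩
  let σ : AddMonoidAlgebra K G → MvPolynomial (Fin s) K := fun p =>
    p.coeff.sum fun d c => monomial (rep d) c
  have hσadd : ∀ p q, σ (p + q) = σ p + σ q := by
    intro p q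
    simp only [σ, AddMonoidAlgebra.coeff_add]
    exact Finsupp.sum_add_index' (fun _ => by simp) (fun _ _ _ => by simp)
  have hσ0 : σ 0 = 0 := by simp [σ]
  have hσs : ∀ d c, σ (AddMonoidAlgebra.single d c) = monomial (rep d) c := by
    intro d c
    simp [σ]
  have key : ∀ f, f - σ (φ f) ∈ J := by
    intro f
    induction f using MvPolynomial.induction_on' with
    | monomial a c =>
      rw [hφ, aeval_single_monomial, hσs]
      have h1 := hJ a (rep (deg a)) (hrep a).symm
      have h2 := J.mul_mem_left (C c) h1
      rwa [mul_sub, C_mul_monomial, C_mul_monomial, mul_one] at h2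
    | add p q hp hq =>
      rw [map_add, hσadd, add_sub_add_comm]
      exact J.add_mem hp hq
  have := key f
  rwa [hf, hσ0, sub_zero] at this

theorem toric_ideal_binomial_stci_is_ci {s r n : ℕ} {K : Type*} [Field K] [CharZero K]
    (v : Fin s → Fin n → ℤ) (P : Ideal (MvPolynomial (Fin s) K))
    (hP : P = RingHom.ker (MvPolynomial.aeval
      (fun i => (AddMonoidAlgebra.single (v i) (1 : K) : AddMonoidAlgebra K (Fin n → ℤ))) :
        MvPolynomial (Fin s) K →ₐ[K] AddMonoidAlgebra K (Fin n → ℤ)).toRingHom)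
    (hht : idealHeight P = r)
    (g : Fin r → MvPolynomial (Fin s) K) (hg : ∀ j, IsBinomial (g j))
    (hrad : P = (Ideal.span (Set.range g)).radical) :
    P = Ideal.span (Set.range g) := by
  have hφm := aeval_single_monomial (K := K) v
  set φ := (MvPolynomial.aeval (R := K)
      (fun i => (AddMonoidAlgebra.single (v i) (1 : K) : AddMonoidAlgebra K (Fin n → ℤ)))) with hφ
  have hmem : ∀ f, f ∈ P ↔ φ f = 0 := by
    intro f
    rw [hP]
    exact RingHom.mem_ker
  have hPp : P.IsPrime := by
    rw [hP]
    exact RingHom.ker_isPrime _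
  have hheight : P.height = r := by
    rw [← hht, PrimeSpectrum.height_eq_orderHeight ⟨P, hPp⟩]
    apply le_antisymm
    · refine le_iInf₂ fun p hp => Order.height_mono ?_
      exact hp
    · exact iInf₂_le (⟨P, hPp⟩ : PrimeSpectrum _) (le_refl P)
  set I := Ideal.span (Set.range g) with hI
  have hIP : I ≤ P := by
    rw [hrad]; exact Ideal.le_radical
  refine le_antisymm ?_ hIP
  have hreg : ∀ c : Fin s →₀ ℕ, RegMod I (monomial c (1 : K)) := by
    intro c
    refine global_unmixed P hheight g hrad _ ?_
    rw [hmem, hφm]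
    simp
  choose a b hab using hg
  have hgI : ∀ j, monomial (toFs (a j)) (1 : K) - monomial (toFs (b j)) 1 ∈ I := by
    intro j
    rw [← hab]
    exact Ideal.subset_span ⟨j, rfl⟩
  let L : AddSubgroup (Fin s → ℤ) :=
    AddSubgroup.closure (Set.range fun j => intVec (a j) - intVec (b j))
  let w : Fin s → (Fin s → ℤ) ⧸ L := fun i => QuotientAddGroup.mk (Pi.single i 1)
  have hw : ∀ c : Fin s →₀ ℕ, ∑ i, c i • w i = QuotientAddGroup.mk' L (fun i => (c i : ℤ)) := by
    intro c
    have : (fun i => (c i : ℤ)) = ∑ i, c i • (Pi.single i 1 : Fin s → ℤ) := by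
      ext k
      simp [Finset.sum_apply, Pi.single_apply]
    rw [this, map_sum]
    exact Finset.sum_congr rfl fun i _ => by rw [map_nsmul]; rfl
  have hψm := aeval_single_monomial (K := K) w
  set ψ := (MvPolynomial.aeval (R := K)
      (fun i => (AddMonoidAlgebra.single (w i) (1 : K) :
        AddMonoidAlgebra K ((Fin s → ℤ) ⧸ L)))) with hψ
  have hψI : I ≤ RingHom.ker ψ := by
    refine Ideal.span_le.2 ?_
    rintro _ ⟨j, rfl⟩
    rw [SetLike.mem_coe, RingHom.mem_ker, hab, map_sub, hψm, hψm, hw, hw, sub_eq_zero]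
    congr 1
    rw [← sub_eq_zero, ← map_sub]
    exact (QuotientAddGroup.eq_zero_iff _).2 (AddSubgroup.subset_closure ⟨j, rfl⟩)
  intro f hf
  refine toric_spanned v I ?_ f ((hmem f).1 hf)
  intro c d hcd
  have h1 : monomial c (1 : K) - monomial d 1 ∈ P := by
    rw [hmem, map_sub, hφm, hφm, hcd, sub_self]
  rw [hrad] at h1
  obtain ⟨N, hN⟩ := h1
  have h2 : ψ ((monomial c (1 : K) - monomial d 1) ^ N) = 0 := hψI hN
  set C' := ∑ i, c i • w i with hC
  set D' := ∑ i, d i • w i with hD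
  have h3 : C' - D' = 0 := by
    apply nilp_unip (K := K) _ N
    rw [map_pow, map_sub, hψm, hψm] at h2
    have h4 : (AddMonoidAlgebra.single (C' - D') (1 : K) : AddMonoidAlgebra K _) - 1 =
        AddMonoidAlgebra.single (-D') 1 *
          (AddMonoidAlgebra.single C' 1 - AddMonoidAlgebra.single D' 1) := by
      rw [mul_sub, AddMonoidAlgebra.single_mul_single, AddMonoidAlgebra.single_mul_single,
        neg_add_cancel, neg_add_eq_sub, one_mul]
      rfl
    rw [h4, mul_pow, h2, mul_zero]
  rw [hC, hD, hw, hw, ← map_sub] at h3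
  have h5 := (QuotientAddGroup.eq_zero_iff _).1 h3
  obtain ⟨a1, b1, h6, h7⟩ := lattice_lift I a b hgI _ h5
  have h8 : b1 + c = d + a1 := by
    ext i
    have := h6 i
    simp only [Pi.sub_apply] at this
    simp only [Finsupp.add_apply]
    omega
  apply hreg b1
  have h9 : monomial b1 (1 : K) * (monomial c 1 - monomial d 1) =
      monomial d 1 * (monomial a1 1 - monomial b1 1) := by
    rw [mul_sub, mul_sub, monomial_mul, monomial_mul, monomial_mul, monomial_mul, h8, add_comm b1 d]
  rw [h9]
  exact I.mul_mem_left _ h7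
end
end

section
/- Let P ⊂ S be the toric ideal of a monomial curve defined by positive integers ω_1,...,ω_s (i.e., P is the kernel of the map K[t_1,...,t_s] → K[y] with t_i ↦ y^{ω_i}). Then P is a complete intersection if and only if there exist binomials g_1,...,g_{s-1} in P, homogeneous with respect to the grading deg(t_i) = ω_i, such that (a) the lattice ker(ψ) ⊂ ℤ^s (where ψ: ℤ^s → ℤ sends e_i to ω_i) is generated by ĝ_1,...,ĝ_{s-1}, and (b) V(g_1,...,g_{s-1}, t_i) = {0} for i = 1,...,s. -/
open MvPolynomial

noncomputable section

/-- The monomial with exponent vector `u`. -/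
abbrev mon {s : ℕ} (K : Type*) [Field K] (u : Fin s → ℕ) : MvPolynomial (Fin s) K :=
  monomial (toFs u) (1 : K)

/-- The weight of an exponent vector. -/
def wt {s : ℕ} (w : Fin s → ℕ) (u : Fin s → ℕ) : ℕ := ∑ i, u i * w i

/-- Homogeneous binomials. -/
def hbin {s : ℕ} (K : Type*) [Field K] (w : Fin s → ℕ) : Set (MvPolynomial (Fin s) K) :=
  {f | ∃ u v, wt w u = wt w v ∧ f = mon K u - mon K v}

lemma toFs_add {s : ℕ} (u v : Fin s → ℕ) : toFs (u + v) = toFs u + toFs v := by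
  ext i; simp [toFs]

lemma mon_add {s : ℕ} {K : Type*} [Field K] (u v : Fin s → ℕ) :
    mon K (u + v) = mon K u * mon K v := by
  simp [mon, toFs_add, monomial_mul]

lemma wt_add {s : ℕ} (w u v : Fin s → ℕ) : wt w (u + v) = wt w u + wt w v := by
  simp [wt, add_mul, Finset.sum_add_distrib]

lemma mon_single {s : ℕ} {K : Type*} [Field K] (i : Fin s) :
    mon K (Pi.single i 1) = X i := by
  have : toFs (Pi.single i 1) = Finsupp.single i 1 := by
    ext k; simp [toFs, Finsupp.single_apply, Pi.single_apply, eq_comm]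
  rw [mon, this]; rfl

lemma mon_zero {s : ℕ} {K : Type*} [Field K] : mon K (0 : Fin s → ℕ) = 1 := by
  have : toFs (0 : Fin s → ℕ) = 0 := by ext k; simp [toFs]
  rw [mon, this]; rfl

lemma wt_single {s : ℕ} (w : Fin s → ℕ) (i : Fin s) (k : ℕ) : wt w (Pi.single i k) = k * w i := by
  rw [wt, Finset.sum_eq_single i] <;> simp +contextual [Pi.single_apply]

lemma phi_mon {s : ℕ} {K : Type*} [Field K] (w u : Fin s → ℕ) :
    MvPolynomial.aeval (fun i => (Polynomial.X : Polynomial K) ^ w i) (mon K u)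
      = Polynomial.X ^ wt w u := by
  rw [mon, aeval_monomial, map_one, one_mul, Finsupp.prod_fintype _ _ (by simp)]
  simp [wt, ← pow_mul, Finset.prod_pow_eq_pow_sum, mul_comm]

lemma eval_mon {s : ℕ} {K : Type*} [Field K] (x : Fin s → K) (u : Fin s → ℕ) :
    eval x (mon K u) = ∏ i, x i ^ u i := by
  rw [mon, eval_monomial, one_mul, Finsupp.prod_fintype _ _ (by simp)]
  simp

lemma phi_ker {s : ℕ} {K : Type*} [Field K] (w : Fin s → ℕ) (f : MvPolynomial (Fin s) K)
    (hf : MvPolynomial.aeval (fun i => (Polynomial.X : Polynomial K) ^ w i) f = 0) :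
    f ∈ Submodule.span K (hbin K w) := by
  classical
  set N := Submodule.span K (hbin K w) with hN
  let rep : ℕ → Fin s → ℕ := fun d => if h : ∃ u, wt w u = d then h.choose else 0
  have hrep : ∀ u, wt w (rep (wt w u)) = wt w u := by
    intro u
    have h : ∃ u', wt w u' = wt w u := ⟨u, rfl⟩
    simp only [rep, dif_pos h]
    exact h.choose_spec
  let ρ : Polynomial K →ₗ[K] (MvPolynomial (Fin s) K ⧸ N) :=
    (Polynomial.basisMonomials K).constr K (fun d => N.mkQ (mon K (rep d)))
  have hρ : ∀ d, ρ (Polynomial.X ^ d) = N.mkQ (mon K (rep d)) := by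
    intro d
    have := (Polynomial.basisMonomials K).constr_basis K (fun d => N.mkQ (mon K (rep d))) d
    rw [Polynomial.coe_basisMonomials] at this
    rw [← Polynomial.monomial_one_right_eq_X_pow]
    exact this
  have key : ρ ∘ₗ (MvPolynomial.aeval (fun i => (Polynomial.X : Polynomial K) ^ w i) :
      MvPolynomial (Fin s) K →ₐ[K] Polynomial K).toLinearMap = N.mkQ := by
    refine (MvPolynomial.basisMonomials (Fin s) K).ext fun u => ?_
    obtain ⟨u, rfl⟩ := (Finsupp.equivFunOnFinite : (Fin s →₀ ℕ) ≃ (Fin s → ℕ)).symm.surjective u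
    rw [MvPolynomial.coe_basisMonomials]
    change ρ (MvPolynomial.aeval _ (mon K u)) = N.mkQ (mon K u)
    rw [phi_mon, hρ, ← sub_eq_zero, ← map_sub, Submodule.mkQ_apply, Submodule.Quotient.mk_eq_zero]
    exact Submodule.subset_span ⟨_, _, hrep u, rfl⟩
  have := congrArg (fun g => g f) key
  simp only [LinearMap.comp_apply, AlgHom.toLinearMap_apply, hf, map_zero] at this
  rw [← Submodule.Quotient.mk_eq_zero N, ← Submodule.mkQ_apply, ← this]

/-- restriction of an integer vector to a set of coordinates -/
def rst {s : ℕ} (A : Fin s → Prop) [DecidablePred A] : (Fin s → ℤ) →+ (Fin s → ℤ) where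
  toFun l := fun i => if A i then l i else 0
  map_zero' := by ext; simp
  map_add' := by intro x y; ext i; by_cases h : A i <;> simp [h]

lemma sub_pow_mem {s : ℕ} {K : Type*} [Field K] (I : Ideal (MvPolynomial (Fin s) K))
    (α β : Fin s → ℕ) (h : mon K α - mon K β ∈ I) (n : ℕ) :
    mon K (n • α) - mon K (n • β) ∈ I := by
  have e : ∀ γ : Fin s → ℕ, mon K (n • γ) = mon K γ ^ n := by
    intro γ
    induction n with
    | zero => simp only [zero_smul, pow_zero, mon_zero]
    | succ n ih => rw [succ_nsmul, mon_add, ih, pow_succ]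
  rw [e, e]
  exact Ideal.mem_of_dvd _ (sub_dvd_pow_sub_pow _ _ _) h

lemma merge {s : ℕ} {K : Type*} [Field K] (I : Ideal (MvPolynomial (Fin s) K))
    (L : AddSubgroup (Fin s → ℤ)) (A : Fin s → Prop) [DecidablePred A]
    (hL : ∀ u v : Fin s → ℕ, intVec u - intVec v ∈ L → mon K u - mon K v ∈ I)
    (hA : ∀ l ∈ L, rst A l ∈ L)
    (α β : Fin s → ℕ) (hα : ∀ i, ¬ A i → α i = 0) (hβ : ∀ i, A i → β i = 0)
    (h : mon K α - mon K β ∈ I) (u v : Fin s → ℕ)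
    (huv : intVec u - intVec v ∈ L ⊔ AddSubgroup.zmultiples (intVec α - intVec β)) :
    mon K u - mon K v ∈ I := by
  have main : ∀ (n : ℕ) (u v : Fin s → ℕ) (l : Fin s → ℤ), l ∈ L →
      intVec u - intVec v = l + (n : ℤ) • (intVec α - intVec β) → mon K u - mon K v ∈ I := by
    intro n u v l hl e
    have e' : ∀ i, (u i : ℤ) - v i = l i + n * (α i - β i) := by
      intro i; have := congrFun e i; simpa using this
    let p : Fin s → ℕ := fun i => if A i then v i else u i
    have h1 : mon K u - mon K (p + n • α) ∈ I := by
      apply hL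
      convert hA l hl using 1
      ext i
      have := e' i
      by_cases hi : A i
      · rw [hβ i hi] at this; simp [p, rst, hi, intVec] at this ⊢; linarith
      · simp [p, rst, hi, hα i hi, intVec]
    have h2 : mon K (p + n • α) - mon K (p + n • β) ∈ I := by
      rw [mon_add, mon_add, ← mul_sub]
      exact I.mul_mem_left _ (sub_pow_mem I α β h n)
    have h3 : mon K (p + n • β) - mon K v ∈ I := by
      apply hL
      convert L.sub_mem hl (hA l hl) using 1
      ext i
      have := e' i
      by_cases hi : A i
      · simp [p, rst, hi, hβ i hi, intVec]
      · rw [hα i hi] at this; simp [p, rst, hi, intVec] at this ⊢; linarith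
    have := I.add_mem (I.add_mem h1 h2) h3
    convert this using 1
    ring
  obtain ⟨l, hl, z, hz, e⟩ := AddSubgroup.mem_sup.1 huv
  obtain ⟨k, rfl⟩ := AddSubgroup.mem_zmultiples_iff.1 hz
  obtain ⟨n, rfl | rfl⟩ := k.eq_nat_or_neg
  · exact main n u v l hl e.symm
  · have := main n v u (-l) (L.neg_mem hl) (by
      rw [← neg_sub, ← e]; simp only [neg_smul, neg_add, neg_neg])
    rw [← neg_sub]; exact I.neg_mem this

lemma core {s m : ℕ} {K : Type*} [Field K] (I : Ideal (MvPolynomial (Fin s) K))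
    (a b : Fin m → Fin s → ℕ) (hI : ∀ j, mon K (a j) - mon K (b j) ∈ I)
    (h0 : ∀ j, a j = 0 ↔ b j = 0)
    (hsep : ∀ B : Fin s → Prop, (∃ i, B i) → (∃ i, ¬ B i) →
      ∃ j, ¬ ((∀ i, a j i ≠ 0 → B i) ↔ (∀ i, b j i ≠ 0 → B i))) :
    ∀ (n : ℕ) (f : Fin s → Fin s) (L : AddSubgroup (Fin s → ℤ)) (R : Finset (Fin m)),
      (Finset.univ.image f).card = n → R.card ≤ n - 1 →
      (∀ l ∈ L, ∀ c, rst (fun i => f i = c) l ∈ L) →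
      (∀ u v : Fin s → ℕ, intVec u - intVec v ∈ L → mon K u - mon K v ∈ I) →
      (∀ j, j ∉ R → intVec (a j) - intVec (b j) ∈ L) →
      (∀ j, j ∉ R → ∃ c, (∀ i, a j i ≠ 0 → f i = c) ∧ (∀ i, b j i ≠ 0 → f i = c)) →
      ∃ L : AddSubgroup (Fin s → ℤ),
        (∀ u v : Fin s → ℕ, intVec u - intVec v ∈ L → mon K u - mon K v ∈ I) ∧
        ∀ j, intVec (a j) - intVec (b j) ∈ L := by
  intro n
  induction n using Nat.strong_induction_on with
  | _ n ih =>
  intro f L R hn hR h1 h2 h3 h4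
  by_cases hn1 : n ≤ 1
  · have : R = ∅ := by rw [← Finset.card_eq_zero]; omega
    subst this
    exact ⟨L, h2, fun j => h3 j (by simp)⟩
  push Not at hn1
  -- choose rows
  have hrow : ∀ c ∈ Finset.univ.image f, ∃ j ∈ R,
      ¬ ((∀ i, a j i ≠ 0 → f i = c) ↔ (∀ i, b j i ≠ 0 → f i = c)) := by
    intro c hc
    obtain ⟨i0, -, hi0⟩ := Finset.mem_image.1 hc
    obtain ⟨c', hc', hne⟩ := Finset.exists_mem_ne (by omega : 1 < (Finset.univ.image f).card) c
    obtain ⟨i1, -, hi1⟩ := Finset.mem_image.1 hc'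
    obtain ⟨j, hj⟩ := hsep (fun i => f i = c) ⟨i0, hi0⟩ ⟨i1, by rw [hi1]; exact hne⟩
    refine ⟨j, ?_, hj⟩
    by_contra hjR
    obtain ⟨d, ha, hb⟩ := h4 j hjR
    apply hj
    by_cases haz : a j = 0
    · have hbz := (h0 j).1 haz
      simp [haz, hbz]
    · have hbz : b j ≠ 0 := fun h => haz ((h0 j).2 h)
      obtain ⟨i, hi⟩ := Function.ne_iff.1 haz
      obtain ⟨k, hk⟩ := Function.ne_iff.1 hbz
      constructor
      · intro h i' hi'
        rw [hb i' hi', ← ha i hi, h i hi]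
      · intro h i' hi'
        rw [ha i' hi', ← hb k hk, h k hk]
  have hne : Nonempty (Fin m) := by
    obtain ⟨c, hc⟩ := Finset.card_pos.1 (by omega : 0 < (Finset.univ.image f).card)
    exact ⟨(hrow c hc).choose⟩
  choose! J hJR hJ using hrow
  obtain ⟨c, hc, d, hd, hcd, hJcd⟩ := Finset.exists_ne_map_eq_of_card_lt_of_maps_to
    (by omega : R.card < (Finset.univ.image f).card) (f := J) (fun c hc => hJR c hc)
  have hJc := hJ c hc
  have hJd := hJ d hd
  rw [← hJcd] at hJd
  have hjR := hJR c hc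
  generalize J c = j at hJc hJd hjR
  have haz : a j ≠ 0 := by
    intro haz
    have hbz := (h0 j).1 haz
    simp [haz, hbz] at hJc
  have hbz : b j ≠ 0 := fun h => haz ((h0 j).2 h)
  obtain ⟨i, hi⟩ := Function.ne_iff.1 haz
  obtain ⟨k, hk⟩ := Function.ne_iff.1 hbz
  -- general step
  have step : ∀ (α β : Fin s → ℕ) , (∀ i, α i ≠ 0 → f i = c) → (∀ i, β i ≠ 0 → f i = d) →
      mon K α - mon K β ∈ I →
      (intVec (a j) - intVec (b j) ∈ AddSubgroup.zmultiples (intVec α - intVec β)) →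
      (∀ i, a j i ≠ 0 → f i = c ∨ f i = d) → (∀ i, b j i ≠ 0 → f i = c ∨ f i = d) →
      ∃ L : AddSubgroup (Fin s → ℤ),
        (∀ u v : Fin s → ℕ, intVec u - intVec v ∈ L → mon K u - mon K v ∈ I) ∧
        ∀ j, intVec (a j) - intVec (b j) ∈ L := by
    intro α β hα hβ hαβ hz hac hbc
    have himg : (Finset.univ.image (fun i => if f i = d then c else f i))
        = (Finset.univ.image f).erase d := by
      ext e
      simp only [Finset.mem_image, Finset.mem_univ, true_and, Finset.mem_erase]
      constructor
      · rintro ⟨i, rfl⟩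
        split_ifs with h
        · exact ⟨hcd, by simpa using hc⟩
        · exact ⟨h, i, rfl⟩
      · rintro ⟨he, i, rfl⟩
        exact ⟨i, by simp [he]⟩
    refine ih (n - 1) (by omega) (fun i => if f i = d then c else f i)
      (L ⊔ AddSubgroup.zmultiples (intVec α - intVec β)) (R.erase j) ?_ ?_ ?_ ?_ ?_ ?_
    · rw [himg, Finset.card_erase_of_mem hd, hn]
    · rw [Finset.card_erase_of_mem hjR]; omega
    · intro l hl e
      obtain ⟨l, hl', z, hz, rfl⟩ := AddSubgroup.mem_sup.1 hl
      replace hl := hl'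
      rw [map_add]
      by_cases hec : e = c
      · subst hec
        have E1 : rst (fun i => (if f i = d then e else f i) = e) l
            = rst (fun i => f i = e) l + rst (fun i => f i = d) l := by
          ext i
          by_cases hd' : f i = d
          · have : ¬ d = e := fun h => hcd h.symm
            simp [rst, hd', this]
          · simp [rst, hd']
        have E2 : rst (fun i => (if f i = d then e else f i) = e) z = z := by
          obtain ⟨k, rfl⟩ := AddSubgroup.mem_zmultiples_iff.1 hz
          ext i
          by_cases hd' : f i = d
          · simp [rst, hd']
          · by_cases he' : f i = e
            · simp [rst, he']
            · have x1 : α i = 0 := by by_contra h; exact he' (hα i h)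
              have x2 : β i = 0 := by by_contra h; exact hd' (hβ i h)
              simp [rst, x1, x2, intVec]
        rw [E1, E2]
        exact AddSubgroup.add_mem _ (AddSubgroup.mem_sup_left (L.add_mem (h1 l hl _) (h1 l hl _)))
          (AddSubgroup.mem_sup_right hz)
      · have E2 : rst (fun i => (if f i = d then c else f i) = e) z = 0 := by
          obtain ⟨k, rfl⟩ := AddSubgroup.mem_zmultiples_iff.1 hz
          ext i
          by_cases hd' : f i = d
          · have : ¬ c = e := fun h => hec h.symm
            simp [rst, hd', this]
          · have x2 : β i = 0 := by by_contra h; exact hd' (hβ i h)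
            by_cases he' : f i = e
            · have x1 : α i = 0 := by by_contra h; exact hec (he'.symm.trans (hα i h))
              simp [rst, x1, x2, intVec]
            · simp [rst, he', hd']
        rw [E2, add_zero]
        apply AddSubgroup.mem_sup_left
        by_cases hed : e = d
        · convert L.zero_mem
          ext i
          by_cases hd' : f i = d
          · simp [rst, hd', Ne.symm hec]
          · simp [rst, hd', hed]
        · convert h1 l hl e using 1
          ext i
          by_cases hd' : f i = d
          · simp [rst, hd', Ne.symm hec, Ne.symm hed]
          · simp [rst, hd']
    · intro u v huv
      refine merge I L (fun i => f i = c) h2 (fun l hl => h1 l hl c) α β ?_ ?_ hαβ u v huv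
      · intro i hi; by_contra h; exact hi (hα i h)
      · intro i hi; by_contra h; exact hcd (hi.symm.trans (hβ i h))
    · intro j' hj'
      by_cases hjj : j' = j
      · subst hjj; exact AddSubgroup.mem_sup_right hz
      · exact AddSubgroup.mem_sup_left (h3 j' (fun h => hj' (Finset.mem_erase.2 ⟨hjj, h⟩)))
    · intro j' hj'
      by_cases hjj : j' = j
      · subst hjj
        refine ⟨c, fun i hi => ?_, fun i hi => ?_⟩
        · rcases hac i hi with h | h <;> simp [h]
        · rcases hbc i hi with h | h <;> simp [h]
      · obtain ⟨e, ha, hb⟩ := h4 j' (fun h => hj' (Finset.mem_erase.2 ⟨hjj, h⟩))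
        refine ⟨if e = d then c else e, fun i hi => ?_, fun i hi => ?_⟩
        · simp [ha i hi]
        · simp [hb i hi]
  by_cases A1 : ∀ i, a j i ≠ 0 → f i = c
  · have A2 : ∀ i, b j i ≠ 0 → f i = d := by
      by_contra hcon
      have A3 : ∀ i, a j i ≠ 0 → f i = d := by tauto
      exact hcd ((A1 i hi).symm.trans (A3 i hi))
    exact step (a j) (b j) A1 A2 (hI j) (AddSubgroup.mem_zmultiples _)
      (fun i hi => Or.inl (A1 i hi)) (fun i hi => Or.inr (A2 i hi))
  · have B1 : ∀ i, b j i ≠ 0 → f i = c := by tauto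
    have B2 : ∀ i, a j i ≠ 0 → f i = d := by
      by_contra hcon
      have A3 : ∀ i, b j i ≠ 0 → f i = d := by tauto
      exact hcd ((B1 k hk).symm.trans (A3 k hk))
    refine step (b j) (a j) B1 B2 ?_ ?_
      (fun i hi => Or.inr (B2 i hi)) (fun i hi => Or.inl (B1 i hi))
    · rw [← neg_sub]; exact I.neg_mem (hI j)
    · rw [← neg_sub (intVec (b j))]; exact AddSubgroup.neg_mem _ (AddSubgroup.mem_zmultiples _)

lemma wt_eq_zero {s : ℕ} (w : Fin s → ℕ) (hw : ∀ i, 0 < w i) (u : Fin s → ℕ) :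
    wt w u = 0 ↔ u = 0 := by
  simp only [wt, Finset.sum_eq_zero_iff, Finset.mem_univ, true_and, mul_eq_zero, funext_iff,
    Pi.zero_apply]
  exact forall_congr' fun i => by have := (hw i).ne'; simp [this]

lemma eval_ind {s : ℕ} {K : Type*} [Field K] (B : Fin s → Prop) [DecidablePred B]
    (u : Fin s → ℕ) [Decidable (∀ i, u i ≠ 0 → B i)] :
    eval (fun i => if B i then (1 : K) else 0) (mon K u)
      = if (∀ i, u i ≠ 0 → B i) then 1 else 0 := by
  rw [eval_mon]
  split_ifs with h
  · apply Finset.prod_eq_one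
    intro i _
    by_cases hu : u i = 0
    · simp [hu]
    · simp [h i hu]
  · push Not at h
    obtain ⟨i, hu, hB⟩ := h
    exact Finset.prod_eq_zero (Finset.mem_univ i) (by simp [hB, hu])

lemma span_le_of_hbin {s : ℕ} {K : Type*} [Field K] (w : Fin s → ℕ)
    (I : Ideal (MvPolynomial (Fin s) K)) (h : hbin K w ⊆ I) (f : MvPolynomial (Fin s) K)
    (hf : f ∈ Submodule.span K (hbin K w)) : f ∈ I :=
  (Submodule.span_le (p := I.restrictScalars K)).2 h hf

/-- the hard direction -/
lemma bwd {s m : ℕ} {K : Type*} [Field K] (hm : m ≤ s - 1) (w : Fin s → ℕ) (hw : ∀ i, 0 < w i)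
    (a b : Fin m → Fin s → ℕ) (hwt : ∀ j, wt w (a j) = wt w (b j))
    (hlat : ∀ c : Fin s → ℤ, ∑ i, c i * (w i : ℤ) = 0 →
          c ∈ AddSubgroup.closure (Set.range fun j => intVec (a j) - intVec (b j)))
    (hz : ∀ i : Fin s, zeroSet
          (Ideal.span (Set.range fun j => mon K (a j) - mon K (b j)) ⊔
            Ideal.span {X i}) = {0}) :
    hbin K w ⊆ Ideal.span (Set.range fun j => mon K (a j) - mon K (b j)) := by
  classical
  set I := Ideal.span (Set.range fun j => mon K (a j) - mon K (b j)) with hIdef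
  have hI : ∀ j, mon K (a j) - mon K (b j) ∈ I := fun j => Ideal.subset_span ⟨j, rfl⟩
  obtain ⟨L, hL1, hL2⟩ := core I a b hI
    (fun j => by rw [← wt_eq_zero w hw, ← wt_eq_zero w hw, hwt j]) (by
      rintro B ⟨i1, hi1⟩ ⟨i0, hi0⟩
      by_contra! hcon
      have : (fun i => if B i then (1 : K) else 0) ∈ zeroSet (I ⊔ Ideal.span {X i0}) := by
        have hle : I ⊔ Ideal.span {X i0} ≤
            RingHom.ker (eval (fun i => if B i then (1 : K) else 0)) := by
          refine sup_le (Ideal.span_le.2 ?_) (Ideal.span_le.2 ?_)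
          · rintro _ ⟨j, rfl⟩
            simp only [SetLike.mem_coe, RingHom.mem_ker, map_sub]
            rw [eval_ind, eval_ind, sub_eq_zero]
            simp only [hcon j]
          · rintro _ rfl
            simp [RingHom.mem_ker, hi0]
        exact fun f hf => hle hf
      rw [hz i0] at this
      have := congrFun this i1
      simp [hi1] at this) s id ⊥ Finset.univ
    (by simp) (by simpa using hm) (by
      rintro l hl c
      rw [AddSubgroup.mem_bot] at hl ⊢
      rw [hl, map_zero]) (by
      intro u v huv
      rw [AddSubgroup.mem_bot] at huv
      have : u = v := by
        ext i; have := congrFun huv i; simp [intVec] at this; omega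
      simp [this]) (by simp) (by simp)
  rintro _ ⟨u, v, huv, rfl⟩
  apply hL1
  have hc : AddSubgroup.closure (Set.range fun j => intVec (a j) - intVec (b j)) ≤ L := by
    rw [AddSubgroup.closure_le]
    rintro _ ⟨j, rfl⟩
    exact hL2 j
  apply hc
  apply hlat
  simp only [wt] at huv
  zify at huv
  simp [sub_mul, Finset.sum_sub_distrib, huv]

lemma wt_smul_pi {s : ℕ} (w u : Fin s → ℕ) :
    Finsupp.weight w (toFs u) = wt w u := by
  rw [Finsupp.weight_apply, Finsupp.sum_fintype _ _ (by simp)]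
  simp [wt]

lemma mon_hom {s : ℕ} {K : Type*} [Field K] (w u : Fin s → ℕ) :
    IsWeightedHomogeneous w (mon K u) (wt w u) :=
  isWeightedHomogeneous_monomial _ _ _ (wt_smul_pi w u)

lemma exists_gens {s m : ℕ} {K : Type*} [Field K] (w : Fin s → ℕ) (hw : ∀ i, 0 < w i)
    (P : Ideal (MvPolynomial (Fin s) K))
    (hPB : ∀ f, f ∈ P ↔ f ∈ Submodule.span K (hbin K w))
    (g : Fin m → MvPolynomial (Fin s) K) (hg : P = Ideal.span (Set.range g)) :
    ∃ a b : Fin m → Fin s → ℕ, (∀ j, wt w (a j) = wt w (b j)) ∧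
      P = Ideal.span (Set.range fun j => mon K (a j) - mon K (b j)) := by
  classical
  set M : Submodule K (MvPolynomial (Fin s) K) :=
    Submodule.span K {f | ∃ i, ∃ p ∈ hbin K w, f = X i * p} with hM
  have hXM : ∀ i, ∀ p ∈ P, X i * p ∈ M := by
    intro i p hp
    rw [hPB] at hp
    induction hp using Submodule.span_induction with
    | mem x hx => exact Submodule.subset_span ⟨i, x, hx, rfl⟩
    | zero => simp
    | add x y _ _ hx hy => rw [mul_add]; exact M.add_mem hx hy
    | smul c x _ hx => rw [mul_smul_comm]; exact M.smul_mem c hx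
  have hmul : ∀ (h : MvPolynomial (Fin s) K), ∀ p ∈ P, ∃ c : K, h * p - c • p ∈ M := by
    intro h
    induction h using MvPolynomial.induction_on with
    | C c => intro p hp; exact ⟨c, by rw [MvPolynomial.smul_eq_C_mul, sub_self]; exact M.zero_mem⟩
    | add h1 h2 ih1 ih2 =>
      intro p hp
      obtain ⟨c1, e1⟩ := ih1 p hp
      obtain ⟨c2, e2⟩ := ih2 p hp
      refine ⟨c1 + c2, ?_⟩
      convert M.add_mem e1 e2 using 1
      rw [add_smul]; ring
    | mul_X h i ih =>
      intro p hp
      refine ⟨0, ?_⟩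
      rw [zero_smul, sub_zero, mul_comm h, mul_assoc]
      exact hXM i _ (P.mul_mem_left _ hp)
  -- span of images
  have hV : Submodule.span K (M.mkQ '' hbin K w) ≤ Submodule.span K (Set.range (M.mkQ ∘ g)) := by
    rw [Submodule.span_le]
    rintro _ ⟨f, hf, rfl⟩
    have hfP : f ∈ P := (hPB f).2 (Submodule.subset_span hf)
    rw [hg] at hfP
    obtain ⟨h, rfl⟩ := (Ideal.mem_span_range_iff_exists_fun).1 hfP
    rw [map_sum]
    refine Submodule.sum_mem _ fun j _ => ?_
    obtain ⟨c, hc⟩ := hmul (h j) (g j) (hg ▸ Ideal.subset_span ⟨j, rfl⟩)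
    have : M.mkQ (h j * g j) = c • M.mkQ (g j) := by
      rw [← sub_eq_zero, ← map_smul, ← map_sub, Submodule.mkQ_apply, Submodule.Quotient.mk_eq_zero]
      exact hc
    rw [this]
    exact Submodule.smul_mem _ _ (Submodule.subset_span ⟨j, rfl⟩)
  have hfd : FiniteDimensional K (Submodule.span K (Set.range (M.mkQ ∘ g))) :=
    FiniteDimensional.span_of_finite K (Set.finite_range _)
  have hfd2 : FiniteDimensional K (Submodule.span K (M.mkQ '' hbin K w)) :=
    Submodule.finiteDimensional_of_le hV
  have hr : Module.finrank K (Submodule.span K (M.mkQ '' hbin K w)) ≤ m := by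
    refine (Submodule.finrank_mono hV).trans ?_
    refine (finrank_range_le_card _).trans ?_
    simp
  obtain ⟨e, he1, he2, -⟩ := Submodule.exists_fun_fin_finrank_span_eq K (M.mkQ '' hbin K w)
  have hex : ∀ k, ∃ u v : Fin s → ℕ, wt w u = wt w v ∧ M.mkQ (mon K u - mon K v) = e k := by
    intro k
    obtain ⟨_, ⟨u, v, huv, rfl⟩, h⟩ := he1 k
    exact ⟨u, v, huv, h⟩
  choose a0 b0 hwt0 he0 using hex
  let a : Fin m → Fin s → ℕ := fun j =>
    if h : j.1 < Module.finrank K (Submodule.span K (M.mkQ '' hbin K w)) then a0 ⟨j, h⟩ else 0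
  let b : Fin m → Fin s → ℕ := fun j =>
    if h : j.1 < Module.finrank K (Submodule.span K (M.mkQ '' hbin K w)) then b0 ⟨j, h⟩ else 0
  have hwt : ∀ j, wt w (a j) = wt w (b j) := by
    intro j
    by_cases h : j.1 < Module.finrank K (Submodule.span K (M.mkQ '' hbin K w))
    · simp only [a, b, dif_pos h, hwt0]
    · simp only [a, b, dif_neg h]
  refine ⟨a, b, hwt, ?_⟩
  set I := Ideal.span (Set.range fun j => mon K (a j) - mon K (b j)) with hIdef
  set G := Submodule.span K (Set.range fun j => mon K (a j) - mon K (b j)) with hG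
  have hsub : hbin K w ⊆ (G ⊔ M : Submodule K _) := by
    intro f hf
    have h1 : M.mkQ f ∈ Submodule.span K (Set.range e) := by
      rw [he2]; exact Submodule.subset_span ⟨f, hf, rfl⟩
    have h2 : Submodule.span K (Set.range e) ≤ G.map M.mkQ := by
      rw [Submodule.span_le]
      rintro _ ⟨k, rfl⟩
      refine ⟨mon K (a0 k) - mon K (b0 k), ?_, he0 k⟩
      refine Submodule.subset_span ⟨⟨k, k.2.trans_le hr⟩, ?_⟩
      simp [a, b]
    obtain ⟨x, hx, hxe⟩ := h2 h1
    have : f - x ∈ M := by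
      rw [← Submodule.Quotient.mk_eq_zero M, ← Submodule.mkQ_apply, map_sub, hxe, sub_self]
    rw [← add_sub_cancel x f]
    exact Submodule.add_mem_sup hx this
  have hnak : ∀ d : ℕ, ∀ u v : Fin s → ℕ, wt w u = d → wt w v = d → mon K u - mon K v ∈ I := by
    intro d
    induction d using Nat.strong_induction_on with
    | _ d ih =>
    intro u v hu hv
    let T : Submodule K (MvPolynomial (Fin s) K) :=
      (I.restrictScalars K).comap (weightedHomogeneousComponent w d)
    have hT : G ⊔ M ≤ T := by
      refine sup_le (Submodule.span_le.2 ?_) (Submodule.span_le.2 ?_)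
      · rintro _ ⟨j, rfl⟩
        have hh : IsWeightedHomogeneous w (mon K (a j) - mon K (b j)) (wt w (a j)) :=
          (mon_hom w (a j)).sub (hwt j ▸ mon_hom w (b j))
        change weightedHomogeneousComponent w d (mon K (a j) - mon K (b j)) ∈ I
        by_cases hd : wt w (a j) = d
        · rw [← hd, hh.weightedHomogeneousComponent_same]
          exact Ideal.subset_span ⟨j, rfl⟩
        · rw [hh.weightedHomogeneousComponent_ne d (by first | exact hd | exact Ne.symm hd)]
          exact I.zero_mem
      · rintro _ ⟨i, _, ⟨u', v', huv', rfl⟩, rfl⟩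
        have hh : IsWeightedHomogeneous w (X i * (mon K u' - mon K v')) (w i + wt w u') :=
          (isWeightedHomogeneous_X K w i).mul ((mon_hom w u').sub (huv' ▸ mon_hom w v'))
        change weightedHomogeneousComponent w d (X i * (mon K u' - mon K v')) ∈ I
        by_cases hd : w i + wt w u' = d
        · rw [← hd, hh.weightedHomogeneousComponent_same]
          exact I.mul_mem_left _ (ih (wt w u') (by have := hw i; omega) u' v' rfl huv'.symm)
        · rw [hh.weightedHomogeneousComponent_ne d (by first | exact hd | exact Ne.symm hd)]
          exact I.zero_mem
    have h1 := hT (hsub ⟨u, v, hu.trans hv.symm, rfl⟩)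
    have h2 : weightedHomogeneousComponent w d (mon K u - mon K v) ∈ I := h1
    have hh : IsWeightedHomogeneous w (mon K u - mon K v) d :=
      (hu ▸ mon_hom w u).sub (hv ▸ mon_hom w v)
    rwa [hh.weightedHomogeneousComponent_same] at h2
  apply le_antisymm
  · intro f hf
    refine span_le_of_hbin w I ?_ f ((hPB f).1 hf)
    rintro _ ⟨u, v, huv, rfl⟩
    exact hnak _ u v huv rfl
  · rw [hIdef, Ideal.span_le]
    rintro _ ⟨j, rfl⟩
    exact (hPB _).2 (Submodule.subset_span ⟨_, _, hwt j, rfl⟩)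

/-- exponents of binomials in a binomial ideal differ by lattice elements -/
lemma lat_of_mem {s m : ℕ} {K : Type*} [Field K] (a b : Fin m → Fin s → ℕ) (u v : Fin s → ℕ)
    (h : mon K u - mon K v ∈ Ideal.span (Set.range fun j => mon K (a j) - mon K (b j))) :
    intVec u - intVec v ∈
      AddSubgroup.closure (Set.range fun j => intVec (a j) - intVec (b j)) := by
  set L := AddSubgroup.closure (Set.range fun j => intVec (a j) - intVec (b j)) with hL
  let q : (Fin s →₀ ℕ) →+ ((Fin s → ℤ) ⧸ L) :=
    (QuotientAddGroup.mk' L).comp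
      { toFun := fun x => intVec x
        map_zero' := by ext; simp [intVec]
        map_add' := by intro x y; ext; simp [intVec] }
  let Φ := AddMonoidAlgebra.mapDomainRingHom K q
  have hΦ : ∀ u : Fin s → ℕ, Φ (mon K u) =
      AddMonoidAlgebra.single (QuotientAddGroup.mk' L (intVec u)) 1 := by
    intro u
    exact AddMonoidAlgebra.mapDomain_single
  have hle : Ideal.span (Set.range fun j => mon K (a j) - mon K (b j)) ≤ RingHom.ker Φ := by
    rw [Ideal.span_le]
    rintro _ ⟨j, rfl⟩
    simp only [SetLike.mem_coe, RingHom.mem_ker, map_sub]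
    rw [hΦ, hΦ, sub_eq_zero]
    congr 1
    rw [← sub_eq_zero, ← map_sub, QuotientAddGroup.mk'_apply, QuotientAddGroup.eq_zero_iff]
    exact AddSubgroup.subset_closure ⟨j, rfl⟩
  have h2 := hle h
  rw [RingHom.mem_ker, map_sub, hΦ, hΦ, sub_eq_zero] at h2
  have h3 := Finsupp.single_left_injective (one_ne_zero (α := K)) (congrArg (fun x => x.coeff) h2)
  rw [← sub_eq_zero, ← map_sub, QuotientAddGroup.mk'_apply, QuotientAddGroup.eq_zero_iff] at h3
  exact h3

theorem ci_criterion_monomial_curves {s : ℕ} {K : Type*} [Field K]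
    (w : Fin s → ℕ) (hw : ∀ i, 0 < w i)
    (P : Ideal (MvPolynomial (Fin s) K))
    (hP : P = RingHom.ker (MvPolynomial.aeval
      (fun i => (Polynomial.X : Polynomial K) ^ w i) :
        MvPolynomial (Fin s) K →ₐ[K] Polynomial K).toRingHom) :
    (∃ g : Fin (s - 1) → MvPolynomial (Fin s) K, P = Ideal.span (Set.range g)) ↔
      ∃ a b : Fin (s - 1) → Fin s → ℕ,
        (∀ j, monomial (toFs (a j)) (1 : K) - monomial (toFs (b j)) 1 ∈ P) ∧
        (∀ j, ∑ i, a j i * w i = ∑ i, b j i * w i) ∧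
        (∀ c : Fin s → ℤ,
          c ∈ AddSubgroup.closure (Set.range fun j => intVec (a j) - intVec (b j)) ↔
            ∑ i, c i * (w i : ℤ) = 0) ∧
        ∀ i : Fin s, zeroSet
          (Ideal.span (Set.range fun j =>
            monomial (toFs (a j)) (1 : K) - monomial (toFs (b j)) 1) ⊔
            Ideal.span {X i}) = {0} := by
  have hmem : ∀ f, f ∈ P ↔
      MvPolynomial.aeval (fun i => (Polynomial.X : Polynomial K) ^ w i) f = 0 := by
    intro f; rw [hP]; rfl
  have hPB : ∀ f, f ∈ P ↔ f ∈ Submodule.span K (hbin K w) := by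
    intro f
    constructor
    · intro hf; exact phi_ker w f ((hmem f).1 hf)
    · refine span_le_of_hbin w P ?_ f
      rintro _ ⟨u, v, huv, rfl⟩
      rw [SetLike.mem_coe, hmem, map_sub, phi_mon, phi_mon, huv, sub_self]
  constructor
  · rintro ⟨g, hg⟩
    obtain ⟨a, b, hwt, hPab⟩ := exists_gens w hw P hPB g hg
    refine ⟨a, b, fun j => ?_, hwt, fun c => ⟨fun hc => ?_, fun hc => ?_⟩, fun i => ?_⟩
    · exact (hPB _).2 (Submodule.subset_span ⟨_, _, hwt j, rfl⟩)
    · induction hc using AddSubgroup.closure_induction with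
      | mem x hx =>
        obtain ⟨j, rfl⟩ := hx
        have := hwt j
        simp only [wt] at this
        zify at this
        simp [sub_mul, Finset.sum_sub_distrib, this]
      | zero => simp
      | add x y _ _ hx hy => simp [add_mul, Finset.sum_add_distrib, hx, hy]
      | neg x _ hx => simp [hx]
    · have hc' : c = intVec (fun i => (c i).toNat) - intVec (fun i => (-c i).toNat) := by
        ext i; simp [intVec]
      rw [hc']
      apply lat_of_mem (K := K)
      rw [← hPab, hPB]
      refine Submodule.subset_span ⟨_, _, ?_, rfl⟩
      simp only [wt]
      zify
      rw [← sub_eq_zero, ← Finset.sum_sub_distrib, ← hc]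
      refine Finset.sum_congr rfl fun i _ => ?_
      rw [← sub_mul]
      congr 1
      have := congrFun hc' i
      simp at this ⊢
    · rw [← hPab]
      ext x
      simp only [Set.mem_singleton_iff]
      constructor
      · intro hx
        have hxi : x i = 0 := by
          have := hx (X i) (Ideal.mem_sup_right (Ideal.subset_span rfl))
          simpa using this
        ext k
        have hb : mon K (Pi.single k (w i)) - mon K (Pi.single i (w k)) ∈ P :=
          (hPB _).2 (Submodule.subset_span
            ⟨_, _, by rw [wt_single, wt_single, mul_comm], rfl⟩)
        have := hx _ (Ideal.mem_sup_left hb)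
        rw [map_sub, eval_mon, eval_mon, Finset.prod_eq_single k, Finset.prod_eq_single i] at this
        · simp only [Pi.single_eq_same, hxi, zero_pow (hw k).ne', sub_zero] at this
          exact eq_zero_of_pow_eq_zero this
        · intro l _ hl; simp [hl]
        · simp
        · intro l _ hl; simp [hl]
        · simp
      · rintro rfl
        have hle : P ⊔ Ideal.span {X i} ≤ RingHom.ker (eval (0 : Fin s → K)) := by
          refine sup_le ?_ (Ideal.span_le.2 ?_)
          · intro f hf
            refine span_le_of_hbin w _ ?_ f ((hPB f).1 hf)
            rintro _ ⟨u, v, huv, rfl⟩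
            rw [SetLike.mem_coe, RingHom.mem_ker, map_sub, eval_mon, eval_mon]
            have e : ∀ u : Fin s → ℕ, ∏ i, (0 : Fin s → K) i ^ u i
                = if wt w u = 0 then 1 else 0 := by
              intro u
              rw [if_congr (wt_eq_zero w hw u) rfl rfl]
              split_ifs with h
              · simp [h]
              · obtain ⟨k, hk⟩ := Function.ne_iff.1 h
                exact Finset.prod_eq_zero (Finset.mem_univ k) (by simpa using hk)
            rw [e, e, huv, sub_self]
          · rintro _ rfl
            simp [RingHom.mem_ker]
        exact fun f hf => hle hf
  · rintro ⟨a, b, hab, hwt, hlat, hz⟩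
    refine ⟨fun j => monomial (toFs (a j)) (1 : K) - monomial (toFs (b j)) 1, ?_⟩
    apply le_antisymm
    · intro f hf
      exact span_le_of_hbin w _ (bwd le_rfl w hw a b hwt (fun c hc => (hlat c).2 hc) hz) f
        ((hPB f).1 hf)
    · rw [Ideal.span_le]
      rintro _ ⟨j, rfl⟩
      exact hab j
end
end

section
/- In S = ℚ[t_1, t_2, t_3], the ideal I = (t_1^2 - t_2 t_3, t_1^2 - t_1 t_2) has height 2, is not a lattice ideal (t_1 is a zerodivisor on S/I), and V(I, t_1) ≠ {0}. -/
open MvPolynomial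

noncomputable section

lemma ker_height_aux (p : PrimeSpectrum (MvPolynomial (Fin 3) ℚ))
    (g : Fin 3 → MvPolynomial (Fin 3) ℚ) (hg : ∀ i, g i - X i ∈ p.asIdeal)
    (u : MvPolynomial (Fin 3) ℚ) (hu : aeval g u = 0) (hu0 : u ≠ 0)
    (v : MvPolynomial (Fin 3) ℚ) (hv : v ∈ p.asIdeal) (hgv : aeval g v ≠ 0) :
    2 ≤ Order.height p := by
  let φ : MvPolynomial (Fin 3) ℚ →ₐ[ℚ] MvPolynomial (Fin 3) ℚ := aeval g
  have hcomp : (Ideal.Quotient.mkₐ ℚ p.asIdeal).comp φ = Ideal.Quotient.mkₐ ℚ p.asIdeal := by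
    apply MvPolynomial.algHom_ext
    intro i
    simp only [φ, AlgHom.comp_apply, aeval_X, Ideal.Quotient.mkₐ_eq_mk]
    exact (Ideal.Quotient.eq).2 (hg i)
  let q : PrimeSpectrum (MvPolynomial (Fin 3) ℚ) := ⟨RingHom.ker φ, RingHom.ker_isPrime _⟩
  have hqp : q < p := by
    refine lt_of_le_of_ne ?_ ?_
    · intro f hf
      have hf' : φ f = 0 := hf
      have h := DFunLike.congr_fun hcomp f
      rw [AlgHom.comp_apply, hf', map_zero] at h
      exact Ideal.Quotient.eq_zero_iff_mem.1 h.symm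
    · intro h
      rw [← h] at hv
      exact hgv hv
  let z : PrimeSpectrum (MvPolynomial (Fin 3) ℚ) := ⟨⊥, Ideal.isPrime_bot⟩
  have hzq : z < q := by
    refine lt_of_le_of_ne ?_ ?_
    · exact (bot_le : (⊥ : Ideal (MvPolynomial (Fin 3) ℚ)) ≤ _)
    · intro h
      have : u ∈ q.asIdeal := hu
      rw [← h] at this
      exact hu0 this
  have h1 := Order.height_add_one_le hzq
  have h2 := Order.height_add_one_le hqp
  calc (2 : ℕ∞) = 0 + 1 + 1 := by norm_num
    _ ≤ Order.height z + 1 + 1 := by gcongr; exact zero_le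
    _ ≤ Order.height q + 1 := by gcongr
    _ ≤ _ := h2

lemma lattice_aux (L : AddSubgroup (Fin 3 → ℤ))
    (h : X 0 * (X 0 - X 1) ∈ latticeIdeal ℚ L) : (X 0 - X 1 : MvPolynomial (Fin 3) ℚ) ∈ latticeIdeal ℚ L := by
  let e : Fin 3 → (Fin 3 → ℤ) ⧸ L := fun i => QuotientAddGroup.mk (Pi.single i 1)
  let ψ : MvPolynomial (Fin 3) ℚ →ₐ[ℚ] AddMonoidAlgebra ℚ ((Fin 3 → ℤ) ⧸ L) :=
    aeval (fun i => AddMonoidAlgebra.single (e i) 1)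
  have hmon : ∀ a : Fin 3 → ℕ, ψ (monomial (toFs a) 1) =
      AddMonoidAlgebra.single (QuotientAddGroup.mk (intVec a)) 1 := by
    intro a
    have : intVec a = a 0 • Pi.single 0 1 + a 1 • Pi.single 1 1 + a 2 • Pi.single 2 1 := by
      ext i; fin_cases i <;> simp [intVec]
    rw [this]
    simp only [ψ, aeval_monomial]
    rw [Finsupp.prod_fintype _ _ (by simp)]
    simp [Fin.sum_univ_three, AddMonoidAlgebra.single_pow, AddMonoidAlgebra.single_mul_single, e]
  have hker : latticeIdeal ℚ L ≤ RingHom.ker ψ := by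
    refine Ideal.span_le.2 ?_
    rintro f ⟨a, ha, rfl⟩
    show ψ _ = 0
    rw [map_sub, hmon, hmon, sub_eq_zero]
    congr 1
    rw [QuotientAddGroup.eq]
    convert L.neg_mem ha using 1
    ext i
    simp [intVec]
    omega
  have h0 : ψ (X 0 * (X 0 - X 1)) = 0 := hker h
  have h1 : ψ (X 0) = ψ (X 1) := by
    rw [map_mul, map_sub] at h0
    have h2 := congrArg (fun y => AddMonoidAlgebra.single (-(e 0)) 1 * y) h0
    simp only [← mul_assoc, mul_zero] at h2
    have h3 : AddMonoidAlgebra.single (-(e 0)) 1 * ψ (X 0) = 1 := by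
      simp [ψ, AddMonoidAlgebra.single_mul_single, AddMonoidAlgebra.one_def]
    rw [h3, one_mul, sub_eq_zero] at h2
    exact h2
  have h4 : e 1 = e 0 := by
    simp only [ψ, aeval_X] at h1
    exact ((AddMonoidAlgebra.single_left_injective (one_ne_zero)) h1).symm
  have h5 := (QuotientAddGroup.eq).1 h4
  refine Ideal.subset_span ⟨_, h5, ?_⟩
  have ha : (toFs fun i : Fin 3 => ((-Pi.single 1 1 + Pi.single 0 1 : Fin 3 → ℤ) i).toNat)
      = Finsupp.single 0 1 := by
    ext i; fin_cases i <;> simp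
  have hb : (toFs fun i : Fin 3 => (-(-Pi.single 1 1 + Pi.single 0 1 : Fin 3 → ℤ) i).toNat)
      = Finsupp.single 1 1 := by
    ext i; fin_cases i <;> simp
  rw [ha, hb]
  rfl

theorem example_non_lattice_ideal_Q3 :
    ∀ I : Ideal (MvPolynomial (Fin 3) ℚ),
      I = Ideal.span {X 0 ^ 2 - X 1 * X 2, X 0 ^ 2 - X 0 * X 1} →
      idealHeight I = 2 ∧
      (¬ ∃ 𝓛 : AddSubgroup (Fin 3 → ℤ), I = latticeIdeal ℚ 𝓛) ∧
      (∃ f : MvPolynomial (Fin 3) ℚ, X 0 * f ∈ I ∧ f ∉ I) ∧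
      zeroSet (I ⊔ Ideal.span {X 0}) ≠ {0} := by
  intro I hI
  have hg1 : (X 0 ^ 2 - X 1 * X 2 : MvPolynomial (Fin 3) ℚ) ∈ I := by
    rw [hI]; exact Ideal.subset_span (by simp)
  have hg2 : (X 0 * (X 0 - X 1) : MvPolynomial (Fin 3) ℚ) ∈ I := by
    rw [hI]; exact Ideal.subset_span (by right; simp; ring)
  have hev : ∀ f ∈ I, eval (![0, 1, 0] : Fin 3 → ℚ) f = 0 := by
    have : I ≤ RingHom.ker (eval (![0, 1, 0] : Fin 3 → ℚ)) := by
      rw [hI, Ideal.span_le]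
      rintro f (rfl | rfl) <;> simp [RingHom.mem_ker]
    exact this
  have hnot : (X 0 - X 1 : MvPolynomial (Fin 3) ℚ) ∉ I := by
    intro h
    have := hev _ h
    simp at this
  refine ⟨le_antisymm ?_ ?_, ?_, ⟨X 0 - X 1, hg2, hnot⟩, ?_⟩
  · have hle : idealHeight I ≤ I.height := by
      rw [Ideal.height_eq_inf_minimalPrimes]
      refine le_iInf₂ fun J hJ => ?_
      have hJp : J.IsPrime := hJ.1.1
      have := PrimeSpectrum.height_eq_orderHeight ⟨J, hJp⟩
      rw [this]
      exact iInf₂_le (⟨J, hJp⟩ : PrimeSpectrum _) hJ.1.2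
    refine hle.trans ?_
    have hne : I ≠ ⊤ := fun h => hnot (h ▸ Submodule.mem_top)
    refine (Ideal.height_le_spanFinrank I hne).trans ?_
    rw [hI]
    have := Submodule.spanFinrank_span_le_ncard_of_finite (R := MvPolynomial (Fin 3) ℚ)
      (s := ({X 0 ^ 2 - X 1 * X 2, X 0 ^ 2 - X 0 * X 1} : Set (MvPolynomial (Fin 3) ℚ))) (Set.toFinite _)
    exact_mod_cast this.trans ((Set.ncard_insert_le _ _).trans (by simp))
  · refine le_iInf₂ fun p hp => ?_
    have hp' : I ≤ p.asIdeal := hp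
    have hX : ∀ i j : Fin 3, i ≠ j → (X i - X j : MvPolynomial (Fin 3) ℚ) ≠ 0 := by
      intro i j hij h
      exact hij (X_injective (sub_eq_zero.1 h))
    rcases p.isPrime.mem_or_mem (hp' hg2) with h0 | h0
    · have h12 : (X 1 * X 2 : MvPolynomial (Fin 3) ℚ) ∈ p.asIdeal := by
        have := sub_mem (Ideal.mul_mem_left _ (X 0) h0) (hp' hg1)
        convert this using 1; ring
      have hg : ∀ i, (![0, X 1, X 2] : Fin 3 → MvPolynomial (Fin 3) ℚ) i - X i ∈ p.asIdeal := by
        intro i; fin_cases i <;> simp [h0]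
      rcases p.isPrime.mem_or_mem h12 with h | h
      · exact ker_height_aux p _ hg (X 0) (by simp) (X_ne_zero _) _ h (by simp)
      · exact ker_height_aux p _ hg (X 0) (by simp) (X_ne_zero _) _ h (by simp)
    · have h12 : (X 1 * (X 1 - X 2) : MvPolynomial (Fin 3) ℚ) ∈ p.asIdeal := by
        have := sub_mem (hp' hg1) (Ideal.mul_mem_left _ (X 0 + X 1) h0)
        convert this using 1; ring
      have hg : ∀ i, (![X 1, X 1, X 2] : Fin 3 → MvPolynomial (Fin 3) ℚ) i - X i ∈ p.asIdeal := by
        intro i; fin_cases i <;> simp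
        rw [← neg_sub]; exact neg_mem h0
      rcases p.isPrime.mem_or_mem h12 with h | h
      · exact ker_height_aux p _ hg (X 0 - X 1) (by simp) (hX _ _ (by decide)) _ h (by simp)
      · exact ker_height_aux p _ hg (X 0 - X 1) (by simp) (hX _ _ (by decide)) _ h
          (by simpa using hX 1 2 (by decide))
  · rintro ⟨L, hL⟩
    rw [hL] at hg2 hnot
    exact hnot (lattice_aux L hg2)
  · intro h
    have hm : (![0, 1, 0] : Fin 3 → ℚ) ∈ zeroSet (I ⊔ Ideal.span {X 0}) := by
      have : I ⊔ Ideal.span {X 0} ≤ RingHom.ker (eval (![0, 1, 0] : Fin 3 → ℚ)) := by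
        refine sup_le hev ?_
        rw [Ideal.span_le]
        rintro f rfl
        simp [RingHom.mem_ker]
      exact this
    rw [h] at hm
    have := congrFun (Set.mem_singleton_iff.1 hm) 1
    simp at this
end
end

section
/- Let X be an algebraic toric set over a finite field 𝔽_q parameterized by monomials and let 𝓛 ⊂ ℤ^s be the (unique) homogeneous lattice with I(X) = I(𝓛). Then I(X) is a complete intersection if and only if there exist homogeneous binomials h_1,...,h_{s-1} in I(X) such that: (i) 𝓛 is generated by ĥ_1,...,ĥ_{s-1}; and (ii) V(h_1,...,h_{s-1}, t_i) = {0} for i = 1,...,s. -/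
open MvPolynomial

noncomputable section

/-- The vanishing ideal `I(X)` of the projective algebraic toric set parameterized by the
monomials `x^{v_1}, …, x^{v_s}`. -/
def toricVanishingIdeal {s n : ℕ} (F : Type*) [Field F] [Fintype F]
    (v : Fin s → Fin n → ℕ) : Ideal (MvPolynomial (Fin s) F) :=
  Ideal.span {f | (∃ d : ℕ, f.IsHomogeneous d) ∧
    ∀ x : Fin n → Fˣ, eval (fun i => ∏ j, (x j : F) ^ v i j) f = 0}

section CM
universe u
open RingTheory.Sequence IsLocalRing CategoryTheory Abelian Pointwise

lemma cm_ann_step {R : Type u} [CommRing R] {M : Type*} [AddCommGroup M] [Module R M]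
    (f : R) (fs : List R) :
    Module.annihilator R M ⊔ Ideal.ofList (f :: fs) ≤
      Module.annihilator R (QuotSMulTop f M) ⊔ Ideal.ofList fs := by
  rw [Ideal.ofList_cons, ← sup_assoc]
  refine sup_le_sup_right (sup_le ?_ ?_) _
  · exact LinearMap.annihilator_le_of_surjective (Submodule.mkQ (f • (⊤ : Submodule R M)))
      (Submodule.mkQ_surjective _)
  · rw [Ideal.span_singleton_le_iff_mem, Module.mem_annihilator]
    intro y
    obtain ⟨z, rfl⟩ := Submodule.mkQ_surjective _ y
    rw [← map_smul]
    simp only [Submodule.mkQ_apply, Submodule.Quotient.mk_eq_zero]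
    exact Submodule.smul_mem_pointwise_smul z f ⊤ trivial

variable {R : Type u} [CommRing R] [IsNoetherianRing R] [IsLocalRing R]

lemma cm_upper (fs : List R) : ∀ (M : Type u) [AddCommGroup M] [Module R M] [Module.Finite R M],
    (∀ f ∈ fs, f ∈ maximalIdeal R) →
    maximalIdeal R ≤ (Module.annihilator R M ⊔ Ideal.ofList fs).radical →
    Module.supportDim R M ≤ fs.length := by
  induction fs with
  | nil =>
    intro M _ _ _ _ h
    simp only [Ideal.ofList_nil, bot_le, sup_of_le_left] at h
    have : Subsingleton (Module.support R M) := by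
      have key : ∀ p : Module.support R M, p.1.asIdeal = maximalIdeal R := by
        intro p
        have h2 := p.2
        rw [Module.mem_support_iff_of_finite] at h2
        refine le_antisymm (le_maximalIdeal p.1.2.ne_top) (h.trans ?_)
        exact (p.1.2.radical_le_iff).2 h2
      refine ⟨fun p q => Subtype.ext (PrimeSpectrum.ext ((key p).trans (key q).symm))⟩
    simp only [List.length_nil, Nat.cast_zero]
    exact Order.krullDim_nonpos_of_subsingleton
  | cons f fs ih =>
    intro M _ _ _ hm h
    have h1 := Module.supportDim_le_supportDim_quotSMulTop_succ (M := M)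
      (hm f (by simp))
    have h2 := ih (QuotSMulTop f M) (fun g hg => hm g (by simp [hg]))
      (h.trans (Ideal.radical_mono (cm_ann_step f fs)))
    refine h1.trans ?_
    simp only [List.length_cons, Nat.cast_add, Nat.cast_one]
    gcongr

lemma cm_assoc {M : Type u} [AddCommGroup M] [Module R M] [Module.Finite R M] {p : Ideal R}
    (hp : IsAssociatedPrime p M) {x : R} (hx : x ∈ maximalIdeal R) (reg : IsSMulRegular M x) :
    ∃ p', IsAssociatedPrime p' (QuotSMulTop x M) ∧ p ≤ p' ∧ x ∈ p' := by
  obtain ⟨hpp, z, hz⟩ := isAssociatedPrime_iff.mp hp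
  let N := Submodule.torsionBySet R M (p : Set R)
  have hzN : z ∈ N := by
    rw [Submodule.mem_torsionBySet_iff]
    rintro ⟨a, ha⟩
    have : a ∈ p := ha
    rw [hz, Submodule.mem_colon_singleton] at this
    simpa using this
  have hz0 : z ≠ 0 := by
    rintro rfl
    apply hpp.ne_top
    rw [hz, Ideal.eq_top_iff_one, Submodule.mem_colon_singleton]
    simp
  by_cases hN : N ≤ x • (⊤ : Submodule R M)
  · exfalso
    have hle : N ≤ maximalIdeal R • N := by
      intro y hy
      obtain ⟨w, -, hw⟩ := (Submodule.mem_smul_pointwise_iff_exists _ _ _).mp (hN hy)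
      rw [← hw]
      refine Submodule.smul_mem_smul hx ?_
      rw [Submodule.mem_torsionBySet_iff] at hy ⊢
      intro a
      apply reg
      simp only [smul_zero]
      rw [smul_comm, hw]
      exact hy a
    have := Submodule.eq_bot_of_le_smul_of_le_jacobson_bot _ N (IsNoetherian.noetherian N) hle
      (maximalIdeal_le_jacobson _)
    rw [this] at hzN
    exact hz0 (by simpa using hzN)
  · obtain ⟨y, hyN, hy⟩ := Set.not_subset.mp hN
    have hy0 : (Submodule.Quotient.mk y : QuotSMulTop x M) ≠ 0 := by
      intro h
      exact hy ((Submodule.Quotient.mk_eq_zero _).mp h)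
    obtain ⟨P, hP, hle⟩ := exists_le_isAssociatedPrime_of_isNoetherianRing R _ hy0
    refine ⟨P, hP, fun a ha => hle ?_, hle ?_⟩
    · rw [Submodule.mem_colon_singleton]
      have := (Submodule.mem_torsionBySet_iff _ _).mp hyN ⟨a, ha⟩
      simp only at this
      rw [← Submodule.Quotient.mk_smul]
      simp only [Submodule.mem_bot]
      rw [show a • y = 0 from this]
      simp
    · rw [Submodule.mem_colon_singleton, ← Submodule.Quotient.mk_smul]
      simp only [Submodule.mem_bot, Submodule.Quotient.mk_eq_zero]
      exact Submodule.smul_mem_pointwise_smul y x ⊤ trivial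

lemma cm_lower (rs : List R) : ∀ (M : Type u) [AddCommGroup M] [Module R M] [Module.Finite R M]
    {p : Ideal R}, IsAssociatedPrime p M → (∀ r ∈ rs, r ∈ maximalIdeal R) →
    IsWeaklyRegular M rs → (rs.length : WithBot ℕ∞) ≤ ringKrullDim (R ⧸ p) := by
  induction rs with
  | nil =>
    intro M _ _ _ p hp _ _
    have := hp.isPrime
    simp only [List.length_nil, Nat.cast_zero]
    exact ringKrullDim_nonneg_of_nontrivial
  | cons x rs ih =>
    intro M _ _ _ p hp hm hreg
    rw [isWeaklyRegular_cons_iff] at hreg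
    obtain ⟨p', hp', hle, hx⟩ := cm_assoc hp (hm x (by simp)) hreg.1
    have h1 := ih (QuotSMulTop x M) hp' (fun r hr => hm r (by simp [hr])) hreg.2
    have := hp.isPrime
    have hxp : x ∉ p := by
      obtain ⟨hpp, z, hz⟩ := isAssociatedPrime_iff.mp hp
      intro hxp
      have h2 := hxp
      rw [hz, Submodule.mem_colon_singleton] at h2
      have : z = 0 := hreg.1 (by simpa using h2)
      subst this
      apply hpp.ne_top
      rw [hz, Ideal.eq_top_iff_one, Submodule.mem_colon_singleton]
      simp
    have h2 : ringKrullDim ((R ⧸ p) ⧸ Ideal.span {Ideal.Quotient.mk p x}) + 1 ≤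
        ringKrullDim (R ⧸ p) := by
      apply ringKrullDim_quotient_succ_le_of_nonZeroDivisor
      rw [mem_nonZeroDivisors_iff_ne_zero]
      rwa [Ne, Ideal.Quotient.eq_zero_iff_mem]
    have h3 : ringKrullDim (R ⧸ p') ≤
        ringKrullDim ((R ⧸ p) ⧸ Ideal.span {Ideal.Quotient.mk p x}) := by
      refine ringKrullDim_le_of_surjective
        (Ideal.Quotient.lift _ (Ideal.Quotient.factor hle) ?_) ?_
      · intro a ha
        rw [← RingHom.mem_ker]
        revert a
        change Ideal.span _ ≤ _
        rw [Ideal.span_singleton_le_iff_mem, RingHom.mem_ker, Ideal.Quotient.factor_mk,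
          Ideal.Quotient.eq_zero_iff_mem]
        exact hx
      · exact Ideal.Quotient.lift_surjective_of_surjective _ _ (Ideal.Quotient.factor_surjective hle)
    simp only [List.length_cons, Nat.cast_add, Nat.cast_one]
    refine le_trans ?_ h2
    gcongr
    exact h1.trans h3

lemma cm_first (f : R) (fs : List R) (M : Type u) [AddCommGroup M] [Module R M]
    [Module.Finite R M] (rs : List R) (hrs : ∀ r ∈ rs, r ∈ maximalIdeal R)
    (hreg : IsWeaklyRegular M rs) (hlen : rs.length = fs.length + 1)
    (hm : ∀ g ∈ f :: fs, g ∈ maximalIdeal R)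
    (h : maximalIdeal R ≤ (Module.annihilator R M ⊔ Ideal.ofList (f :: fs)).radical) :
    IsSMulRegular M f := by
  by_contra hf
  have : f ∈ {r : R | IsSMulRegular M r}ᶜ := hf
  rw [← biUnion_associatedPrimes_eq_compl_regular R M] at this
  simp only [Set.mem_iUnion] at this
  obtain ⟨p, hp, hfp⟩ := this
  have hp : IsAssociatedPrime p M := hp
  have hl := cm_lower rs M hp hrs hreg
  have hle1 : Module.annihilator R M ⊔ Ideal.ofList (f :: fs) ≤ p ⊔ Ideal.ofList fs := by
    rw [Ideal.ofList_cons, ← sup_assoc]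
    have hann : Module.annihilator R M ≤ p := by
      obtain ⟨hpp, z, hz⟩ := isAssociatedPrime_iff.mp hp
      intro a ha
      rw [hz, Submodule.mem_colon_singleton, Module.mem_annihilator.mp ha z]
      exact zero_mem _
    refine sup_le_sup_right (sup_le hann ?_) _
    rw [Ideal.span_singleton_le_iff_mem]
    exact hfp
  have hle2 : maximalIdeal R ≤ (Module.annihilator R (R ⧸ p) ⊔ Ideal.ofList fs).radical := by
    rw [Ideal.annihilator_quotient]
    exact h.trans (Ideal.radical_mono hle1)
  have hu := cm_upper fs (R ⧸ p) (fun g hg => hm g (List.mem_cons_of_mem _ hg)) hle2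
  rw [Module.supportDim_quotient_eq_ringKrullDim] at hu
  have h3 := hl.trans hu
  rw [hlen] at h3
  have : fs.length + 1 ≤ fs.length := by exact_mod_cast h3
  omega

/-- System-of-parameters type sequences are regular on modules of large depth. -/
lemma cm_regular (fs : List R) : ∀ (M : ModuleCat.{u} R) [Module.Finite R M] [Nontrivial M],
    (∀ i < fs.length, Subsingleton
      (Ext (ModuleCat.of R (R ⧸ maximalIdeal R)) M i)) →
    (∀ f ∈ fs, f ∈ maximalIdeal R) →
    maximalIdeal R ≤ (Module.annihilator R M ⊔ Ideal.ofList fs).radical →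
    IsWeaklyRegular M fs := by
  induction fs with
  | nil => intro M _ _ _ _ _; exact IsWeaklyRegular.nil R M
  | cons f fs ih =>
    intro M _ _ hext hm h
    have hfm := hm f (by simp)
    have hlt : maximalIdeal R • (⊤ : Submodule R M) < ⊤ := by
      rw [lt_top_iff_ne_top]
      exact (Submodule.top_ne_ideal_smul_of_le_jacobson_annihilator
        (maximalIdeal_le_jacobson _)).symm
    obtain ⟨rs, hlen, hrs, hreg⟩ := ModuleCat.exists_isRegular_of_exists_subsingleton_ext
      (maximalIdeal R) (fs.length + 1) M hlt (ModuleCat.of R (R ⧸ maximalIdeal R))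
      (by
        change Module.support R (R ⧸ maximalIdeal R) = _
        rw [Module.support_eq_zeroLocus, Ideal.annihilator_quotient]) hext
    have hf : IsSMulRegular M f := cm_first f fs M rs hrs hreg.toIsWeaklyRegular hlen hm h
    rw [isWeaklyRegular_cons_iff]
    refine ⟨hf, ?_⟩
    have : Nontrivial (QuotSMulTop f M) := nontrivial_quotSMulTop_of_mem_maximalIdeal M hfm
    refine ih (ModuleCat.of R (QuotSMulTop f M)) ?_ (fun g hg => hm g (by simp [hg]))
      (h.trans (Ideal.radical_mono (cm_ann_step f fs)))
    intro i hi
    have zero1 := AddCommGrpCat.isZero_of_iff_subsingleton.mpr (hext i (by simp; omega))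
    have zero2 := AddCommGrpCat.isZero_of_iff_subsingleton.mpr (hext (i + 1) (by simp; omega))
    exact AddCommGrpCat.subsingleton_of_isZero <| ShortComplex.Exact.isZero_of_both_zeros
      ((Ext.covariant_sequence_exact₃' (ModuleCat.of R (R ⧸ maximalIdeal R))
        hf.smulShortComplex_shortExact) i (i + 1) rfl)
      (zero1.eq_zero_of_src _) (zero2.eq_zero_of_tgt _)

/-- If `R` has a regular sequence of length `n`, then any `n` elements generating an ideal
primary to the maximal ideal form a regular sequence. -/
lemma cm_main (rs fs : List R) (hrs : ∀ r ∈ rs, r ∈ maximalIdeal R) (hreg : IsRegular R rs)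
    (hlen : fs.length = rs.length) (hfs : ∀ r ∈ fs, r ∈ maximalIdeal R)
    (h : maximalIdeal R ≤ (Ideal.ofList fs).radical) : IsWeaklyRegular R fs := by
  refine cm_regular fs (ModuleCat.of R R) ?_ hfs (h.trans (Ideal.radical_mono le_sup_right))
  rw [hlen]
  refine ModuleCat.subsingleton_ext_of_exists_isRegular (maximalIdeal R)
    (ModuleCat.of R (R ⧸ maximalIdeal R)) ?_ (ModuleCat.of R R) ?_ rs hrs hreg
  · change Module.support R (R ⧸ maximalIdeal R) ⊆ _
    rw [Module.support_eq_zeroLocus, Ideal.annihilator_quotient]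
  · change maximalIdeal R • (⊤ : Submodule R R) < ⊤
    rw [lt_top_iff_ne_top]
    exact (Submodule.top_ne_ideal_smul_of_le_jacobson_annihilator
        (maximalIdeal_le_jacobson _)).symm
end CM

section Poly
open RingTheory.Sequence IsLocalRing Pointwise
attribute [local instance] MvPolynomial.gradedAlgebra

variable {s : ℕ} {F : Type*} [Field F]

lemma tor_homog_span {T : Set (MvPolynomial (Fin s) F)}
    (hT : ∀ f ∈ T, ∃ d : ℕ, f.IsHomogeneous d) :
    (Ideal.span T).IsHomogeneous (homogeneousSubmodule (Fin s) F) :=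
  Ideal.homogeneous_span _ _ fun x hx => by
    obtain ⟨d, hd⟩ := hT x hx
    exact ⟨d, hd⟩

lemma tor_comp_mul {w g : MvPolynomial (Fin s) F} {d : ℕ} (hg : g.IsHomogeneous d) :
    homogeneousComponent d (w * g) = C (coeff 0 w) * g := by
  conv_lhs => rw [← sum_homogeneousComponent (φ := w), Finset.sum_mul, map_sum]
  rw [Finset.sum_eq_single_of_mem 0 (by simp)]
  · rw [homogeneousComponent_zero]
    apply homogeneousComponent_eq_self
    simpa using (isHomogeneous_C (Fin s) (coeff 0 w)).mul hg
  · intro k _ hk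
    rw [homogeneousComponent_of_mem (n := k + d)
      ((homogeneousComponent_isHomogeneous k w).mul hg), if_neg (by omega)]

lemma tor_X_regular : IsWeaklyRegular (MvPolynomial (Fin s) F)
    (List.ofFn (fun i : Fin s => (X i : MvPolynomial (Fin s) F))) := by
  refine ⟨fun i hi => ?_⟩
  rw [isSMulRegular_quotient_iff_mem_of_smul_mem]
  have hi' : i < s := by simpa using hi
  have hspan : (Ideal.ofList ((List.ofFn (fun i : Fin s => (X i : MvPolynomial (Fin s) F))).take i)
      • ⊤ : Submodule (MvPolynomial (Fin s) F) (MvPolynomial (Fin s) F)) =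
      Ideal.span (X '' {j : Fin s | (j : ℕ) < i}) := by
    simp only [smul_eq_mul, Ideal.mul_top]
    unfold Ideal.ofList
    congr 1
    ext f
    simp only [List.mem_take_iff_getElem, Set.mem_ofPred_eq, Set.mem_image, List.getElem_ofFn]
    constructor
    · rintro ⟨j, hj, rfl⟩
      simp at hj
      exact ⟨⟨j, hj.2⟩, hj.1, rfl⟩
    · rintro ⟨j, hj, rfl⟩
      exact ⟨j, by simp; omega, rfl⟩
  rw [hspan]
  intro x hx
  rw [mem_ideal_span_X_image] at hx ⊢
  intro m hm
  simp only [List.getElem_ofFn, smul_eq_mul] at hx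
  obtain ⟨j, hj, hne⟩ := hx (Finsupp.single ⟨i, hi'⟩ 1 + m) (by
    rw [mem_support_iff, coeff_X_mul]
    exact mem_support_iff.mp hm)
  refine ⟨j, hj, ?_⟩
  have : (⟨i, hi'⟩ : Fin s) ≠ j := by
    intro h
    subst h
    simp at hj
  simpa [Finsupp.single_apply, this] using hne

/-- The irrelevant maximal ideal. -/
def torMax (s : ℕ) (F : Type*) [Field F] : Ideal (MvPolynomial (Fin s) F) :=
  RingHom.ker (constantCoeff : MvPolynomial (Fin s) F →+* F)

instance : (torMax s F).IsPrime := RingHom.ker_isPrime _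

lemma tor_mem_max {f : MvPolynomial (Fin s) F} : f ∈ torMax s F ↔ coeff 0 f = 0 := by
  rw [torMax, RingHom.mem_ker, constantCoeff_eq]

lemma tor_max_le {P : Ideal (MvPolynomial (Fin s) F)} (hP : ∀ i, X i ∈ P) : torMax s F ≤ P := by
  have h : torMax s F ≤ Ideal.span (X '' (Set.univ : Set (Fin s))) := by
    intro f hf
    rw [mem_ideal_span_X_image]
    intro m hm
    by_contra hcon
    push Not at hcon
    have : m = 0 := by ext i; simpa using hcon i trivial
    subst this
    exact (mem_support_iff.mp hm) (tor_mem_max.mp hf)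
  refine h.trans (Ideal.span_le.mpr ?_)
  rintro _ ⟨i, -, rfl⟩
  exact hP i

lemma tor_nzd (fs : Fin (s - 1) → MvPolynomial (Fin s) F)
    (hhom : ∀ j, ∃ d : ℕ, (fs j).IsHomogeneous d)
    (hm : ∀ j, fs j ∈ torMax s F) (i : Fin s)
    (hrad : ∀ k, X k ∈ (Ideal.span (Set.range fs) ⊔ Ideal.span {X i}).radical)
    {g : MvPolynomial (Fin s) F} {d : ℕ} (hg : g.IsHomogeneous d)
    (h : X i * g ∈ Ideal.span (Set.range fs)) : g ∈ Ideal.span (Set.range fs) := by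
  have hs : 0 < s := i.pos
  set J := Ideal.span (Set.range fs) with hJ
  have hJh : J.IsHomogeneous (homogeneousSubmodule (Fin s) F) :=
    tor_homog_span (by rintro _ ⟨j, rfl⟩; exact hhom j)
  let R := Localization.AtPrime (torMax s F)
  have hreg := IsWeaklyRegular.isRegular_of_isLocalization_of_mem R (torMax s F)
    (tor_X_regular (s := s) (F := F)) (by
      intro r hr
      simp only [List.mem_ofFn] at hr
      obtain ⟨i, rfl⟩ := hr
      rw [tor_mem_max, coeff_zero_X])
  have hmaxmem : ∀ f ∈ torMax s F, algebraMap (MvPolynomial (Fin s) F) R f ∈ maximalIdeal R := by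
    intro f hf
    exact (IsLocalization.AtPrime.to_map_mem_maximal_iff R (torMax s F) f).mpr hf
  have hofList : ∀ f : Fin (s - 1) → MvPolynomial (Fin s) F,
      Ideal.ofList (List.ofFn f) = Ideal.span (Set.range f) := by
    intro f
    unfold Ideal.ofList
    congr 1
    ext x
    simp [List.mem_ofFn]
  have hw := cm_main _ ((List.ofFn fs).map (algebraMap (MvPolynomial (Fin s) F) R) ++
      [X i].map (algebraMap (MvPolynomial (Fin s) F) R))
    (by
      intro r hr
      simp only [List.mem_map, List.mem_ofFn] at hr
      obtain ⟨_, ⟨k, rfl⟩, rfl⟩ := hr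
      exact hmaxmem _ (by rw [tor_mem_max, coeff_zero_X])) hreg
    (by simp; omega)
    (by
      intro r hr
      simp only [List.mem_append, List.mem_map, List.mem_ofFn, List.mem_singleton] at hr
      rcases hr with ⟨_, ⟨k, rfl⟩, rfl⟩ | ⟨_, rfl, rfl⟩
      · exact hmaxmem _ (hm k)
      · exact hmaxmem _ (by rw [tor_mem_max, coeff_zero_X]))
    (by
      rw [← List.map_append, ← Ideal.map_ofList, Ideal.ofList_append, Ideal.ofList_singleton,
        hofList, ← Localization.AtPrime.map_eq_maximalIdeal]
      refine (Ideal.map_mono (tor_max_le hrad)).trans (Ideal.map_radical_le _))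
  rw [isWeaklyRegular_append_iff] at hw
  have hw2 := hw.2
  rw [List.map_singleton, isWeaklyRegular_singleton_iff,
    isSMulRegular_quotient_iff_mem_of_smul_mem, ← Ideal.map_ofList, hofList] at hw2
  simp only [smul_eq_mul, Ideal.mul_top] at hw2
  have hgR := hw2 (algebraMap _ R g) (by
    rw [← map_mul]
    exact Ideal.mem_map_of_mem _ h)
  rw [IsLocalization.algebraMap_mem_map_algebraMap_iff (torMax s F).primeCompl] at hgR
  obtain ⟨w, hw0, hwg⟩ := hgR
  have hwg' := homogeneousComponent_mem_of_mem hJh hwg d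
  rw [tor_comp_mul hg] at hwg'
  have hc : coeff 0 w ≠ 0 := fun h0 => hw0 (tor_mem_max.mpr h0)
  have := J.mul_mem_left (C (coeff 0 w)⁻¹) hwg'
  rwa [← mul_assoc, ← C_mul, inv_mul_cancel₀ hc, C_1, one_mul] at this

end Poly

section Lattice
open Pointwise
attribute [local instance] MvPolynomial.gradedAlgebra

variable {s : ℕ} {F : Type*} [Field F]

/-- The monomial `t^a`. -/
abbrev torMono (F : Type*) [Field F] {s : ℕ} (a : Fin s → ℕ) : MvPolynomial (Fin s) F :=
  monomial (toFs a) (1 : F)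

lemma tor_mono_add (a b : Fin s → ℕ) : torMono F (a + b) = torMono F a * torMono F b := by
  have h : toFs (a + b) = toFs a + toFs b := by ext; rfl
  rw [torMono, torMono, torMono, monomial_mul, one_mul, h]

lemma tor_mono_eq (a : Fin s → ℕ) : torMono F a = ∏ i, X i ^ a i := by
  rw [torMono, monomial_eq, C_1, one_mul, Finsupp.prod_fintype _ _ (by simp)]
  rfl

lemma tor_mono_homog (a : Fin s → ℕ) : (torMono F a).IsHomogeneous (∑ i, a i) := by
  apply isHomogeneous_monomial
  rw [Finsupp.degree_eq_sum]
  rfl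

lemma tor_binom_homog {a b : Fin s → ℕ} (h : ∑ i, a i = ∑ i, b i) :
    (torMono F a - torMono F b).IsHomogeneous (∑ i, a i) := by
  refine (tor_mono_homog a).sub ?_
  rw [h]
  exact tor_mono_homog b

/-- The map `S → F[ℤ^s/L]`. -/
def torQ (F : Type*) [Field F] {s : ℕ} (L : AddSubgroup (Fin s → ℤ)) :
    MvPolynomial (Fin s) F →ₐ[F] AddMonoidAlgebra F ((Fin s → ℤ) ⧸ L) :=
  aeval fun i => AddMonoidAlgebra.single (QuotientAddGroup.mk (Pi.single i 1)) 1

lemma torQ_mono (L : AddSubgroup (Fin s → ℤ)) (a : Fin s → ℕ) :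
    torQ F L (torMono F a) =
      AddMonoidAlgebra.single (QuotientAddGroup.mk (intVec a) : (Fin s → ℤ) ⧸ L) 1 := by
  rw [tor_mono_eq, map_prod]
  have h1 : ∀ i, torQ F L (X i ^ a i) = AddMonoidAlgebra.of F ((Fin s → ℤ) ⧸ L)
      (Multiplicative.ofAdd (QuotientAddGroup.mk (Pi.single i (a i : ℤ)))) := by
    intro i
    rw [map_pow, torQ, aeval_X, AddMonoidAlgebra.of_apply, AddMonoidAlgebra.single_pow, one_pow]
    congr 1
    rw [← QuotientAddGroup.mk_nsmul, ← Pi.single_smul]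
    simp
  simp only [h1]
  rw [← map_prod, AddMonoidAlgebra.of_apply, ← ofAdd_sum, toAdd_ofAdd]
  congr 1
  have h2 := (map_sum (QuotientAddGroup.mk' L) (fun i => Pi.single i (a i : ℤ)) Finset.univ).symm
  refine h2.trans ?_
  exact congrArg (QuotientAddGroup.mk' L) (Finset.univ_sum_single (intVec a))

lemma torQ_binom (L : AddSubgroup (Fin s → ℤ)) (a b : Fin s → ℕ) :
    torQ F L (torMono F a - torMono F b) = 0 ↔ intVec a - intVec b ∈ L := by
  rw [map_sub, torQ_mono, torQ_mono, sub_eq_zero]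
  constructor
  · intro h
    have := AddMonoidAlgebra.of_injective (R := F) (M := (Fin s → ℤ) ⧸ L)
      (a₁ := Multiplicative.ofAdd (QuotientAddGroup.mk (intVec a)))
      (a₂ := Multiplicative.ofAdd (QuotientAddGroup.mk (intVec b))) h
    have h2 := QuotientAddGroup.eq.mp (Multiplicative.ofAdd.injective this)
    have h3 := L.neg_mem h2
    convert h3 using 1
    abel
  · intro h
    congr 1
    rw [QuotientAddGroup.eq]
    have h3 := L.neg_mem h
    convert h3 using 1
    abel

lemma tor_toNat (a : Fin s → ℤ) :
    intVec (fun i => (a i).toNat) - intVec (fun i => (-a i).toNat) = a := by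
  ext i
  simp only [Pi.sub_apply, intVec]
  omega

lemma tor_lattice_le_ker (L : AddSubgroup (Fin s → ℤ)) :
    latticeIdeal F L ≤ RingHom.ker (torQ F L) := by
  rw [latticeIdeal, Ideal.span_le]
  rintro _ ⟨a, ha, rfl⟩
  rw [SetLike.mem_coe, RingHom.mem_ker]
  exact (torQ_binom L _ _).mpr (by rw [tor_toNat]; exact ha)

lemma tor_sat {n : ℕ} (a b : Fin n → Fin s → ℕ) (x : Fin s → ℤ)
    (hx : x ∈ AddSubgroup.closure (Set.range fun j => intVec (a j) - intVec (b j))) :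
    ∀ u v : Fin s → ℕ, intVec u - intVec v = x → ∃ c : Fin s → ℕ,
      torMono F c * (torMono F u - torMono F v) ∈
        Ideal.span (Set.range fun j => torMono F (a j) - torMono F (b j)) := by
  induction hx using AddSubgroup.closure_induction with
  | mem x hx =>
    obtain ⟨j, rfl⟩ := hx
    intro u v huv
    refine ⟨b j, ?_⟩
    have : torMono F (b j) * (torMono F u - torMono F v) =
        torMono F v * (torMono F (a j) - torMono F (b j)) := by
      rw [mul_sub, mul_sub, ← tor_mono_add, ← tor_mono_add, ← tor_mono_add, ← tor_mono_add,
        add_comm v (b j)]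
      have h : b j + u = v + a j := by
        ext i
        have := congrFun huv i
        simp only [Pi.sub_apply, Pi.add_apply, intVec] at this ⊢
        omega
      rw [h]
    rw [this]
    exact Ideal.mul_mem_left _ _ (Ideal.subset_span ⟨j, rfl⟩)
  | zero =>
    intro u v huv
    have : u = v := by
      ext i
      have := congrFun huv i
      simp only [Pi.sub_apply, Pi.zero_apply, intVec] at this
      omega
    subst this
    exact ⟨0, by simp⟩
  | add x y _ _ hx hy =>
    intro u v huv
    obtain ⟨c1, h1⟩ := hx (u + fun i => (x i).toNat) (u + fun i => (-x i).toNat) (by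
      ext i
      simp only [Pi.sub_apply, Pi.add_apply, intVec]
      push_cast
      omega)
    obtain ⟨c2, h2⟩ := hy (u + fun i => (-x i).toNat) (v + fun i => (x i).toNat) (by
      ext i
      have := congrFun huv i
      simp only [Pi.sub_apply, Pi.add_apply, intVec] at this ⊢
      push_cast
      omega)
    refine ⟨c1 + c2 + fun i => (x i).toNat, ?_⟩
    have := Ideal.add_mem _ (Ideal.mul_mem_left _ (torMono F c2) h1)
      (Ideal.mul_mem_left _ (torMono F c1) h2)
    convert this using 1
    simp only [tor_mono_add]
    ring
  | neg x _ hx =>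
    intro u v huv
    obtain ⟨c, hc⟩ := hx v u (by rw [← neg_sub, huv, neg_neg])
    refine ⟨c, ?_⟩
    have := Ideal.neg_mem_iff _ |>.mpr hc
    convert this using 1
    ring

lemma tor_mono_cancel (J : Ideal (MvPolynomial (Fin s) F))
    (hJ : ∀ (i : Fin s) (g : MvPolynomial (Fin s) F) (d : ℕ), g.IsHomogeneous d →
      X i * g ∈ J → g ∈ J) (c : Fin s → ℕ) (g : MvPolynomial (Fin s) F) (d : ℕ)
    (hg : g.IsHomogeneous d) (h : torMono F c * g ∈ J) : g ∈ J := by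
  let Q : MvPolynomial (Fin s) F → Prop := fun p => (∃ e : ℕ, p.IsHomogeneous e) ∧
    ∀ (g : MvPolynomial (Fin s) F) (d : ℕ), g.IsHomogeneous d → p * g ∈ J → g ∈ J
  have hmul : ∀ p q, Q p → Q q → Q (p * q) := by
    rintro p q ⟨⟨e, he⟩, hp⟩ ⟨⟨e', he'⟩, hq⟩
    refine ⟨⟨_, he.mul he'⟩, fun g d hg h => hq g d hg (hp _ _ (he'.mul hg) ?_)⟩
    rwa [← mul_assoc]
  have hone : Q 1 := ⟨⟨0, isHomogeneous_one _ _⟩, fun g d _ h => by simpa using h⟩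
  have hX : ∀ i, Q (X i) := fun i => ⟨⟨1, isHomogeneous_X _ _⟩, hJ i⟩
  have hQ : Q (torMono F c) := by
    rw [tor_mono_eq]
    refine Finset.prod_induction _ Q hmul hone fun i _ => ?_
    induction c i with
    | zero => simpa using hone
    | succ k ih => rw [pow_succ]; exact hmul _ _ ih (hX i)
  exact hQ.2 g d hg h

/-- A prime containing the binomials and one variable contains all variables. -/
lemma tor_radical {n : ℕ} (a b : Fin n → Fin s → ℕ) (i : Fin s)
    (hz : zeroSet (Ideal.span (Set.range fun j => torMono F (a j) - torMono F (b j)) ⊔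
      Ideal.span {X i}) = {0}) (k : Fin s) :
    X k ∈ (Ideal.span (Set.range fun j => torMono F (a j) - torMono F (b j)) ⊔
      Ideal.span {X i}).radical := by
  classical
  rw [Ideal.radical_eq_sInf, Ideal.mem_sInf]
  rintro P ⟨hle, hP⟩
  let x : Fin s → F := fun l => if X l ∈ P then 0 else 1
  have hmonoP : ∀ c : Fin s → ℕ, torMono F c ∈ P → eval x (torMono F c) = 0 := by
    intro c hc
    rw [tor_mono_eq] at hc ⊢
    obtain ⟨l, -, hl⟩ := (hP.prod_mem_iff).mp hc
    rw [map_prod]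
    refine Finset.prod_eq_zero (Finset.mem_univ l) ?_
    have hc0 : c l ≠ 0 := by
      intro h0
      rw [h0, pow_zero] at hl
      exact hP.ne_top ((Ideal.eq_top_iff_one _).mpr hl)
    rw [map_pow, eval_X]
    have : X l ∈ P := hP.mem_of_pow_mem _ hl
    simp [x, this, hc0]
  have hmonoP' : ∀ c : Fin s → ℕ, torMono F c ∉ P → eval x (torMono F c) = 1 := by
    intro c hc
    rw [tor_mono_eq] at hc ⊢
    rw [map_prod]
    refine Finset.prod_eq_one fun l _ => ?_
    rw [map_pow, eval_X]
    by_cases hc0 : c l = 0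
    · rw [hc0, pow_zero]
    · have : X l ∉ P := by
        intro hl
        apply hc
        exact (hP.prod_mem_iff).mpr ⟨l, Finset.mem_univ l, Ideal.pow_mem_of_mem P hl _ (by omega)⟩
      simp [x, this]
  have hx : x ∈ zeroSet (Ideal.span (Set.range fun j => torMono F (a j) - torMono F (b j)) ⊔
      Ideal.span {X i}) := by
    have : Ideal.span (Set.range fun j => torMono F (a j) - torMono F (b j)) ⊔
      Ideal.span {X i} ≤ RingHom.ker (eval x) := by
      refine sup_le (Ideal.span_le.mpr ?_) (Ideal.span_le.mpr ?_)
      · rintro _ ⟨j, rfl⟩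
        have hj : torMono F (a j) - torMono F (b j) ∈ P :=
          hle (Ideal.mem_sup_left (Ideal.subset_span ⟨j, rfl⟩))
        simp only [SetLike.mem_coe, RingHom.mem_ker, map_sub]
        by_cases ha : torMono F (a j) ∈ P
        · have hb : torMono F (b j) ∈ P := by
            have := P.sub_mem ha hj
            simpa using this
          rw [hmonoP _ ha, hmonoP _ hb, sub_zero]
        · have hb : torMono F (b j) ∉ P := by
            intro hb
            have := P.add_mem hj hb
            rw [sub_add_cancel] at this
            exact ha this
          rw [hmonoP' _ ha, hmonoP' _ hb, sub_self]
      · rintro _ rfl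
        have : X i ∈ P := hle (Ideal.mem_sup_right (Ideal.subset_span rfl))
        simp [x, this]
    intro f hf
    exact this hf
  rw [hz] at hx
  have := congrFun (Set.mem_singleton_iff.mp hx) k
  by_contra hk
  simp [x, hk] at this

end Lattice

section Nakayama
attribute [local instance] MvPolynomial.gradedAlgebra

variable {s : ℕ} {F : Type*} [Field F]

/-- Graded Nakayama. -/
lemma tor_nakayama (I N : Ideal (MvPolynomial (Fin s) F))
    (hI : I.IsHomogeneous (homogeneousSubmodule (Fin s) F))
    (hN : N.IsHomogeneous (homogeneousSubmodule (Fin s) F))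
    (h : I ≤ N ⊔ torMax s F * I) : I ≤ N := by
  have key : ∀ d : ℕ, ∀ f ∈ I, f.IsHomogeneous d → f ∈ N := by
    intro d
    induction d using Nat.strong_induction_on with
    | _ d ih =>
      intro f hf hd
      obtain ⟨n, hn, y, hy, rfl⟩ := Submodule.mem_sup.mp (h hf)
      rw [← homogeneousComponent_eq_self hd, map_add]
      refine N.add_mem (homogeneousComponent_mem_of_mem hN hn d) ?_
      refine Submodule.mul_induction_on hy ?_ ?_
      · intro a ha z hz
        rw [← sum_homogeneousComponent (φ := a), ← sum_homogeneousComponent (φ := z),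
          Finset.sum_mul_sum, map_sum]
        refine N.sum_mem fun k _ => ?_
        rw [map_sum]
        refine N.sum_mem fun l _ => ?_
        rw [homogeneousComponent_of_mem (n := k + l)
          ((homogeneousComponent_isHomogeneous k a).mul (homogeneousComponent_isHomogeneous l z))]
        split_ifs with hkl
        · rcases Nat.eq_zero_or_pos k with rfl | hk
          · rw [homogeneousComponent_zero, tor_mem_max.mp ha, C_0, zero_mul]
            exact N.zero_mem
          · exact N.mul_mem_left _ (ih l (by omega) _ (homogeneousComponent_mem_of_mem hI hz l)
              (homogeneousComponent_isHomogeneous l z))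
        · exact N.zero_mem
      · intro x y hx hy
        rw [map_add]
        exact N.add_mem hx hy
  intro f hf
  rw [← sum_homogeneousComponent (φ := f)]
  exact N.sum_mem fun k _ => key k _ (homogeneousComponent_mem_of_mem hI hf k)
    (homogeneousComponent_isHomogeneous k f)

lemma tor_span_mod (I : Ideal (MvPolynomial (Fin s) F)) (T : Set (MvPolynomial (Fin s) F))
    (hT : I = Ideal.span T) {x : MvPolynomial (Fin s) F} (hx : x ∈ I) :
    ((torMax s F * I).restrictScalars F).mkQ x ∈
      Submodule.span F (((torMax s F * I).restrictScalars F).mkQ '' T) := by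
  have hx' : x ∈ Ideal.span T := hT ▸ hx
  clear hx
  induction hx' using Submodule.span_induction with
  | mem x h => exact Submodule.subset_span ⟨x, h, rfl⟩
  | zero => rw [map_zero]; exact zero_mem _
  | add x y hx hy h1 h2 =>
    rw [map_add]
    exact add_mem h1 h2
  | smul a x hx h1 =>
    have hxI : x ∈ I := by rw [hT]; exact hx
    have : ((torMax s F * I).restrictScalars F).mkQ (a • x) =
        coeff 0 a • ((torMax s F * I).restrictScalars F).mkQ x := by
      rw [← map_smul, ← sub_eq_zero, ← map_sub]
      rw [Submodule.mkQ_apply, Submodule.Quotient.mk_eq_zero, Submodule.restrictScalars_mem]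
      have : a • x - coeff 0 a • x = (a - C (coeff 0 a)) * x := by
        rw [smul_eq_mul, sub_mul, C_mul']
      rw [this]
      exact Ideal.mul_mem_mul (tor_mem_max.mpr (by simp)) hxI
    rw [this]
    exact Submodule.smul_mem _ _ h1

lemma tor_min_gens {n : ℕ} (I : Ideal (MvPolynomial (Fin s) F))
    (B : Set (MvPolynomial (Fin s) F)) (hB : I = Ideal.span B)
    (hBh : ∀ f ∈ B, ∃ d : ℕ, f.IsHomogeneous d) (hB0 : (0 : MvPolynomial (Fin s) F) ∈ B)
    (g : Fin n → MvPolynomial (Fin s) F) (hg : I = Ideal.span (Set.range g)) :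
    ∃ h : Fin n → MvPolynomial (Fin s) F, (∀ j, h j ∈ B) ∧ I = Ideal.span (Set.range h) := by
  classical
  let q := ((torMax s F * I).restrictScalars F).mkQ
  have hBI : B ⊆ I := by rw [hB]; exact Ideal.subset_span
  have hle : Submodule.span F (q '' B) ≤ Submodule.span F (Set.range (q ∘ g)) := by
    rw [Submodule.span_le]
    rintro _ ⟨x, hx, rfl⟩
    rw [Set.range_comp]
    exact tor_span_mod I _ hg (hBI hx)
  have : FiniteDimensional F (Submodule.span F (Set.range (q ∘ g))) :=
    FiniteDimensional.span_of_finite F (Set.finite_range _)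
  have : FiniteDimensional F (Submodule.span F (q '' B)) :=
    Submodule.finiteDimensional_of_le hle
  have hr : Module.finrank F (Submodule.span F (q '' B)) ≤ n := by
    refine (Submodule.finrank_mono hle).trans ?_
    have := finrank_range_le_card (R := F) (q ∘ g)
    simpa [Set.finrank] using this
  obtain ⟨f, hf, hfs, -⟩ := Submodule.exists_fun_fin_finrank_span_eq F (q '' B)
  choose e he heq using hf
  let h : Fin n → MvPolynomial (Fin s) F := fun j =>
    if hj : (j : ℕ) < Module.finrank F (Submodule.span F (q '' B)) then e ⟨j, hj⟩ else 0
  have hhB : ∀ j, h j ∈ B := by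
    intro j
    simp only [h]
    split_ifs
    · exact he _
    · exact hB0
  refine ⟨h, hhB, le_antisymm ?_ ?_⟩
  · refine tor_nakayama I _ (by rw [hB]; exact tor_homog_span hBh)
      (tor_homog_span (by rintro _ ⟨j, rfl⟩; exact hBh _ (hhB j))) ?_
    intro x hx
    have h1 : q x ∈ Submodule.span F (Set.range f) := by
      rw [hfs]; exact tor_span_mod I B hB hx
    have h2 : Submodule.span F (Set.range f) ≤
        ((Ideal.span (Set.range h)).restrictScalars F).map q := by
      rw [Submodule.span_le]
      rintro _ ⟨k, rfl⟩
      refine ⟨e k, Ideal.subset_span ⟨⟨k, lt_of_lt_of_le k.2 hr⟩, ?_⟩, heq k⟩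
      exact dif_pos k.2
    obtain ⟨y, hy, hyx⟩ := h2 h1
    have hxy : x - y ∈ torMax s F * I := by
      have : q (x - y) = 0 := by rw [map_sub, hyx, sub_self]
      rwa [Submodule.mkQ_apply, Submodule.Quotient.mk_eq_zero,
        Submodule.restrictScalars_mem] at this
    exact Submodule.mem_sup.mpr ⟨y, hy, x - y, hxy, by ring⟩
  · rw [Ideal.span_le]
    rintro _ ⟨j, rfl⟩
    exact hBI (hhB j)

end Nakayama

section Main
attribute [local instance] MvPolynomial.gradedAlgebra

variable {s n : ℕ} {F : Type*} [Field F]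

lemma tor_eval_one (a : Fin s → ℕ) : eval (fun _ => (1 : F)) (torMono F a) = 1 := by
  rw [tor_mono_eq, map_prod]
  simp

lemma tor_binom_zero {a b : Fin s → ℕ} (h : ∑ i, a i = ∑ i, b i) :
    eval (0 : Fin s → F) (torMono F a - torMono F b) = 0 := by
  have key : ∀ c : Fin s → ℕ, ∑ i, c i ≠ 0 → eval (0 : Fin s → F) (torMono F c) = 0 := by
    intro c hc
    obtain ⟨i, hi, hci⟩ := Finset.exists_ne_zero_of_sum_ne_zero hc
    rw [tor_mono_eq, map_prod]
    refine Finset.prod_eq_zero hi ?_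
    simp [hci]
  by_cases h0 : ∑ i, a i = 0
  · have ha : a = 0 := by
      ext i
      exact (Finset.sum_eq_zero_iff.mp h0) i (Finset.mem_univ i)
    have hb : b = 0 := by
      ext i
      exact (Finset.sum_eq_zero_iff.mp (h ▸ h0)) i (Finset.mem_univ i)
    rw [ha, hb, sub_self, map_zero]
  · rw [map_sub, key a h0, key b (h ▸ h0), sub_self]

variable [Fintype F]

lemma tor_I_eval (v : Fin s → Fin n → ℕ) :
    toricVanishingIdeal F v ≤ RingHom.ker (eval (fun _ : Fin s => (1 : F))) := by
  rw [toricVanishingIdeal, Ideal.span_le]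
  rintro f ⟨-, hf⟩
  have := hf 1
  simpa using this

lemma tor_I_homog (v : Fin s → Fin n → ℕ) :
    (toricVanishingIdeal F v).IsHomogeneous (homogeneousSubmodule (Fin s) F) := by
  rw [toricVanishingIdeal]
  exact tor_homog_span fun f hf => hf.1

lemma tor_I_degree (v : Fin s → Fin n → ℕ) {a b : Fin s → ℕ}
    (h : torMono F a - torMono F b ∈ toricVanishingIdeal F v) : ∑ i, a i = ∑ i, b i := by
  by_contra hne
  have h1 := homogeneousComponent_mem_of_mem (tor_I_homog v) h (∑ i, a i)
  rw [map_sub, homogeneousComponent_of_mem (tor_mono_homog a),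
    homogeneousComponent_of_mem (tor_mono_homog b), if_pos rfl, if_neg hne, sub_zero] at h1
  have h2 := tor_I_eval v h1
  rw [RingHom.mem_ker, tor_eval_one] at h2
  exact one_ne_zero h2

lemma tor_pow_mem (v : Fin s → Fin n → ℕ) (i k : Fin s) :
    (X k ^ (Fintype.card F - 1) - X i ^ (Fintype.card F - 1) : MvPolynomial (Fin s) F) ∈
      toricVanishingIdeal F v := by
  refine Ideal.subset_span ⟨⟨_, (isHomogeneous_X_pow k _).sub (isHomogeneous_X_pow i _)⟩, ?_⟩
  intro x
  have h : ∀ l, (∏ j, (x j : F) ^ v l j) ^ (Fintype.card F - 1) = 1 := fun l =>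
    FiniteField.pow_card_sub_one_eq_one _
      (Finset.prod_ne_zero_iff.mpr fun j _ => pow_ne_zero _ (x j).ne_zero)
  rw [map_sub, map_pow, map_pow, eval_X, eval_X, h, h, sub_self]

lemma tor_zeroSet (v : Fin s → Fin n → ℕ) {m : ℕ} (a b : Fin m → Fin s → ℕ)
    (hd : ∀ j, ∑ i, a j i = ∑ i, b j i)
    (hI : toricVanishingIdeal F v =
      Ideal.span (Set.range fun j => torMono F (a j) - torMono F (b j))) (i : Fin s) :
    zeroSet (Ideal.span (Set.range fun j => torMono F (a j) - torMono F (b j)) ⊔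
      Ideal.span {X i}) = {0} := by
  ext x
  rw [Set.mem_singleton_iff]
  constructor
  · intro hx
    have hi : x i = 0 := by
      have := hx (X i) (Ideal.mem_sup_right (Ideal.subset_span rfl))
      simpa using this
    have hq : Fintype.card F - 1 ≠ 0 := by
      have := Fintype.one_lt_card (α := F)
      omega
    ext k
    have := hx _ (Ideal.mem_sup_left (hI ▸ tor_pow_mem v i k))
    rw [map_sub, map_pow, map_pow, eval_X, eval_X, hi, zero_pow hq, sub_zero] at this
    exact eq_zero_of_pow_eq_zero this
  · rintro rfl
    have : Ideal.span (Set.range fun j => torMono F (a j) - torMono F (b j)) ⊔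
        Ideal.span {X i} ≤ RingHom.ker (eval (0 : Fin s → F)) := by
      refine sup_le (Ideal.span_le.mpr ?_) (Ideal.span_le.mpr ?_)
      · rintro _ ⟨j, rfl⟩
        exact tor_binom_zero (hd j)
      · rintro _ rfl
        simp
    intro f hf
    exact this hf

end Main

theorem ci_criterion_vanishing_ideal_toric_set {s n : ℕ} (F : Type*) [Field F] [Fintype F]
    (v : Fin s → Fin n → ℕ) (𝓛 : AddSubgroup (Fin s → ℤ))
    (h𝓛 : toricVanishingIdeal F v = latticeIdeal F 𝓛) :
    (∃ g : Fin (s - 1) → MvPolynomial (Fin s) F,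
        toricVanishingIdeal F v = Ideal.span (Set.range g)) ↔
      ∃ a b : Fin (s - 1) → Fin s → ℕ,
        (∀ j, monomial (toFs (a j)) (1 : F) - monomial (toFs (b j)) 1 ∈
          toricVanishingIdeal F v) ∧
        (∀ j, ∑ i, a j i = ∑ i, b j i) ∧
        𝓛 = AddSubgroup.closure (Set.range fun j => intVec (a j) - intVec (b j)) ∧
        ∀ i : Fin s, zeroSet
          (Ideal.span (Set.range fun j =>
            monomial (toFs (a j)) (1 : F) - monomial (toFs (b j)) 1) ⊔
            Ideal.span {X i}) = {0} := by
  have hgen : ∀ a ∈ 𝓛, torMono F (fun i => (a i).toNat) - torMono F (fun i => (-a i).toNat) ∈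
      toricVanishingIdeal F v := by
    intro a ha
    rw [h𝓛]
    exact Ideal.subset_span ⟨a, ha, rfl⟩
  constructor
  · rintro ⟨g, hg⟩
    obtain ⟨h, hB, hI⟩ := tor_min_gens (toricVanishingIdeal F v) _ h𝓛
      (by
        rintro _ ⟨a, ha, rfl⟩
        exact ⟨_, tor_binom_homog (tor_I_degree v (hgen a ha))⟩)
      ⟨0, 𝓛.zero_mem, by simp⟩ g hg
    choose a ha hha using hB
    have hh : h = fun j => torMono F (fun i => (a j i).toNat) -
      torMono F (fun i => (-a j i).toNat) := funext hha
    rw [hh] at hI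
    have hd := fun j => tor_I_degree v (hgen _ (ha j))
    refine ⟨fun j i => (a j i).toNat, fun j i => (-a j i).toNat, fun j => hgen _ (ha j), hd, ?_,
      fun i => tor_zeroSet v _ _ hd hI i⟩
    simp only [tor_toNat]
    refine le_antisymm ?_ ?_
    · intro x hx
      have h1 := hgen x hx
      have h2 : Ideal.span (Set.range fun j => torMono F (fun i => (a j i).toNat) -
          torMono F (fun i => (-a j i).toNat)) ≤
          RingHom.ker (torQ F (AddSubgroup.closure (Set.range fun j => a j))) := by
        rw [Ideal.span_le]
        rintro _ ⟨j, rfl⟩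
        refine (torQ_binom _ _ _).mpr ?_
        rw [tor_toNat]
        exact AddSubgroup.subset_closure ⟨j, rfl⟩
      rw [hI] at h1
      have h3 := (torQ_binom _ _ _).mp (h2 h1)
      rwa [tor_toNat] at h3
    · rw [AddSubgroup.closure_le]
      rintro _ ⟨j, rfl⟩
      exact ha j
  · rintro ⟨a, b, hmem, hd, hL, hz⟩
    refine ⟨fun j => torMono F (a j) - torMono F (b j), le_antisymm ?_ ?_⟩
    · rw [h𝓛, latticeIdeal, Ideal.span_le]
      rintro _ ⟨x, hx, rfl⟩
      have hx' := hx
      rw [hL] at hx'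
      obtain ⟨c, hc⟩ := tor_sat (F := F) a b x hx' _ _ (tor_toNat x)
      refine tor_mono_cancel _ ?_ c _ _ (tor_binom_homog (tor_I_degree v (hgen x hx))) hc
      intro i g d hg hXg
      refine tor_nzd _ (fun j => ⟨_, tor_binom_homog (hd j)⟩) (fun j => ?_) i
        (tor_radical a b i (hz i)) hg hXg
      have h0 := tor_binom_zero (F := F) (hd j)
      rw [tor_mem_max, ← constantCoeff_eq]
      rwa [MvPolynomial.eval_zero] at h0
    · rw [Ideal.span_le]
      rintro _ ⟨j, rfl⟩
      exact hmem j
end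
end
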